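/- Let r = 1 and suppose θ* ∈ ℝ^n has k ≥ 1 jumps with signs 𝔯_1,…,𝔯_k (𝔯_0 = 𝔯_{k+1} = 0) and constant-piece lengths n_0,…,n_k satisfying the length condition: n_i ≥ c₁n/(k+1) and n_i ≤ c₂n/(k+1) for every 0 ≤ i ≤ k with 𝔯_i ≠ 𝔯_{i+1}, where 0 < c₁ ≤ 1 ≤ c₂. Then there is a constant C*(c₁, c₂) depending only on c₁ and c₂ such that λ* ≤ C*(c₁, c₂) · sqrt( (n / Σ_{i=0}^k 1{𝔯_i ≠ 𝔯_{i+1}}) · log(en/(k+1)) ). -/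

import Mathlib

open MeasureTheory ProbabilityTheory
open scoped BigOperators

noncomputable section

/-- Zero-padding of a finite vector to a sequence on `ℕ`. -/
def pad {n : ℕ} (θ : Fin n → ℝ) : ℕ → ℝ := fun t => if h : t < n then θ ⟨t, h⟩ else 0

/-- First-order forward difference of a sequence. -/
def dseq (f : ℕ → ℝ) : ℕ → ℝ := fun t => f (t + 1) - f t

/-- `DD r θ t` is the `t`-th entry (0-indexed) of the `r`-th order difference `D^{(r)} θ`
of the vector `θ ∈ ℝ^n`; only the entries `t < n - r` are meaningful. -/
def DD (r : ℕ) {n : ℕ} (θ : Fin n → ℝ) : ℕ → ℝ := dseq^[r] (pad θ)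

/-- The ℓ¹ norm `‖D^{(r)} θ‖₁`. -/
def Dl1 (r : ℕ) {n : ℕ} (θ : Fin n → ℝ) : ℝ := ∑ t ∈ Finset.range (n - r), |DD r θ t|

/-- The number of nonzero entries `‖D^{(r)} θ‖₀`. -/
def Dl0 (r : ℕ) {n : ℕ} (θ : Fin n → ℝ) : ℕ :=
  ((Finset.range (n - r)).filter fun t => DD r θ t ≠ 0).card

/-- Squared Euclidean norm. -/
def sqnorm {n : ℕ} (x : Fin n → ℝ) : ℝ := ∑ i, x i ^ 2

/-- Euclidean norm. -/
def eunorm {n : ℕ} (x : Fin n → ℝ) : ℝ := Real.sqrt (sqnorm x)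

/-- `V^{(r)}(θ) = n^{r-1} ‖D^{(r)} θ‖₁`. -/
def Vr (r : ℕ) {n : ℕ} (θ : Fin n → ℝ) : ℝ := (n : ℝ) ^ ((r : ℤ) - 1) * Dl1 r θ

/-- The constraint set `K^{(r)}(V) = {θ : ‖D^{(r)} θ‖₁ ≤ V n^{1-r}}`. -/
def Kset (r n : ℕ) (V : ℝ) : Set (Fin n → ℝ) := {θ | Dl1 r θ ≤ V * (n : ℝ) ^ (1 - (r : ℤ))}

/-- `est` is a least-squares projection onto the set `K`. -/
def IsProjOn {n : ℕ} (est : (Fin n → ℝ) → Fin n → ℝ) (K : Set (Fin n → ℝ)) : Prop :=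
  ∀ y, est y ∈ K ∧ ∀ θ ∈ K, sqnorm (y - est y) ≤ sqnorm (y - θ)

/-- `est` is the penalized trend filtering estimator of order `r` with noise level `σ`
and tuning parameter `lam`: it minimizes `½‖y - θ‖² + σ n^{r-1} lam ‖D^{(r)} θ‖₁`. -/
def IsPenEst (r : ℕ) {n : ℕ} (σ lam : ℝ) (est : (Fin n → ℝ) → Fin n → ℝ) : Prop :=
  ∀ y θ, 1 / 2 * sqnorm (y - est y) + σ * (n : ℝ) ^ ((r : ℤ) - 1) * lam * Dl1 r (est y) ≤
    1 / 2 * sqnorm (y - θ) + σ * (n : ℝ) ^ ((r : ℤ) - 1) * lam * Dl1 r θ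

/-- The Gaussian measure `N_n(0, σ² I_n)` on `ℝ^n`. -/
def gaussVec (n : ℕ) (σ : ℝ) : Measure (Fin n → ℝ) :=
  Measure.pi fun _ => gaussianReal 0 (σ ^ 2).toNNReal

/-- The risk `R(θ̂, θ*) = (1/n) E ‖θ̂(θ* + ξ) - θ*‖²` for `ξ ∼ N_n(0, σ² I_n)`. -/
def risk {n : ℕ} (σ : ℝ) (est : (Fin n → ℝ) → Fin n → ℝ) (θs : Fin n → ℝ) : ℝ :=
  1 / (n : ℝ) * ∫ ξ, sqnorm (est (θs + ξ) - θs) ∂gaussVec n σ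

/-- `j` (with signs `sg`) enumerates, in increasing order and paper (1-indexed) convention,
exactly the `r`-th order knots of `θ ∈ ℝ^n`; an index `2 ≤ m ≤ n - r + 1` is a knot when
`(D^{(r-1)}θ)_{m-1} ≠ (D^{(r-1)}θ)_m` (1-indexed entries), and its sign is `+1` when
`(D^{(r-1)}θ)_{m-1} < (D^{(r-1)}θ)_m` and `-1` otherwise. -/
def IsKnotSeq (r n : ℕ) (θ : Fin n → ℝ) (k : ℕ) (j : Fin k → ℕ) (sg : Fin k → ℝ) : Prop :=
  StrictMono j ∧ (∀ i, 2 ≤ j i ∧ j i ≤ n - r + 1) ∧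
    (∀ m : ℕ, 2 ≤ m → m ≤ n - r + 1 →
      (DD (r - 1) θ (m - 2) ≠ DD (r - 1) θ (m - 1) ↔ ∃ i, j i = m)) ∧
    ∀ i, sg i = if DD (r - 1) θ (j i - 2) < DD (r - 1) θ (j i - 1) then 1 else -1

/-- Extended knot sequence: `jext 0 = j_0 = 1`, `jext i = j_i` for `1 ≤ i ≤ k`, and
`jext (k+1) = j_{k+1} = n - r + 2`. -/
def jext (n r k : ℕ) (j : Fin k → ℕ) : ℕ → ℕ := fun i =>
  if i = 0 then 1 else if h : i - 1 < k then j ⟨i - 1, h⟩ else n - r + 2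

/-- Extended sign sequence: `sgext i = 𝔯_i` for `1 ≤ i ≤ k` and `0` otherwise. -/
def sgext (k : ℕ) (sg : Fin k → ℝ) : ℕ → ℝ := fun i =>
  if h : 0 < i ∧ i - 1 < k then sg ⟨i - 1, h.2⟩ else 0

/-- The lengths `n_0 = j_1 + r - 2`, `n_i = j_{i+1} - j_i` (`1 ≤ i ≤ k-1`),
`n_k = n - r + 2 - j_k`. -/
def nlen (n r k : ℕ) (j : Fin k → ℕ) : ℕ → ℕ := fun i =>
  if i = 0 then jext n r k j 1 + r - 2 else jext n r k j (i + 1) - jext n r k j i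

/-- `n_{i*} = min(n_i, n/(k+1))`. -/
def nstar (n r k : ℕ) (j : Fin k → ℕ) (i : ℕ) : ℝ :=
  min (nlen n r k j i : ℝ) ((n : ℝ) / ((k : ℝ) + 1))

/-- `δ_r(θ)²` defined from the knot data of `θ`. -/
def deltaSq (n r k : ℕ) (j : Fin k → ℕ) (sg : Fin k → ℝ) : ℝ :=
  nstar n r k j 0 ^ (1 - 2 * (r : ℤ)) + nstar n r k j k ^ (1 - 2 * (r : ℤ)) +
    ∑ i ∈ Finset.Ico 1 k,
      if sgext k sg i ≠ sgext k sg (i + 1) then nstar n r k j i ^ (1 - 2 * (r : ℤ)) else 0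

/-- `Δ_r(θ)` defined from the knot data of `θ`. -/
def DeltaR (n r k : ℕ) (j : Fin k → ℕ) (sg : Fin k → ℝ) : ℝ :=
  ((k : ℝ) + 1) / (n : ℝ) * Real.log (Real.exp 1 * (n : ℝ) / ((k : ℝ) + 1)) +
    deltaSq n r k j sg / (n : ℝ) * ((n : ℝ) / ((k : ℝ) + 1)) ^ (2 * (r : ℤ) - 1) *
      Real.log (Real.exp 1 * (n : ℝ) / ((k : ℝ) + 1)) +
    (Real.sqrt (deltaSq n r k j sg) / Real.sqrt (n : ℝ)) ^ ((1 : ℝ) / (r : ℝ))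

/-- The minimum length condition with constant `c`: `n_i ≥ c n/(k+1)` for every `0 ≤ i ≤ k`
with `𝔯_i ≠ 𝔯_{i+1}` (where `𝔯_0 = 𝔯_{k+1} = 0`). -/
def MinLen (n r k : ℕ) (j : Fin k → ℕ) (sg : Fin k → ℝ) (c : ℝ) : Prop :=
  ∀ i ≤ k, sgext k sg i ≠ sgext k sg (i + 1) →
    c * (n : ℝ) / ((k : ℝ) + 1) ≤ (nlen n r k j i : ℝ)

/-- The subdifferential of `g` at `θ`. -/
def subdiff {n : ℕ} (g : (Fin n → ℝ) → ℝ) (θ : Fin n → ℝ) : Set (Fin n → ℝ) :=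
  {v | ∀ y, g θ + ∑ i, v i * (y i - θ i) ≤ g y}

/-- `v` is the minimum-norm element of `S`. -/
def IsMinNormIn {n : ℕ} (v : Fin n → ℝ) (S : Set (Fin n → ℝ)) : Prop :=
  v ∈ S ∧ ∀ w ∈ S, eunorm v ≤ eunorm w

/-- `c • S`. -/
def scaleSet {n : ℕ} (c : ℝ) (S : Set (Fin n → ℝ)) : Set (Fin n → ℝ) := (c • ·) '' S

/-- The cone generated by `S`: `⋃_{c ≥ 0} c • S`. -/
def coneOf {n : ℕ} (S : Set (Fin n → ℝ)) : Set (Fin n → ℝ) := ⋃ c ∈ Set.Ici (0 : ℝ), scaleSet c S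

/-- Euclidean distance from a point to a set. -/
def distSet {n : ℕ} (z : Fin n → ℝ) (S : Set (Fin n → ℝ)) : ℝ :=
  sInf ((fun v => eunorm (z - v)) '' S)

/-- Gaussian mean squared distance `D(S) = E dist²(Z, S)`, `Z ∼ N_n(0, I_n)`. -/
def gaussMSD {n : ℕ} (S : Set (Fin n → ℝ)) : ℝ := ∫ z, distSet z S ^ 2 ∂gaussVec n 1

/-- `lam z` is, for each `z`, the minimizer over `λ ≥ 0` of `dist(z, λ S)`. -/
def IsLamFun {n : ℕ} (S : Set (Fin n → ℝ)) (lam : (Fin n → ℝ) → ℝ) : Prop :=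
  ∀ z, 0 ≤ lam z ∧ ∀ μ : ℝ, 0 ≤ μ → distSet z (scaleSet (lam z) S) ≤ distSet z (scaleSet μ S)

/-- Euclidean covering number of `K` at scale `ε`. -/
def covN {n : ℕ} (ε : ℝ) (K : Set (Fin n → ℝ)) : ℕ :=
  sInf {m : ℕ | ∃ a : Fin m → Fin n → ℝ, ∀ x ∈ K, ∃ i, eunorm (x - a i) ≤ ε}

/-- `K` `t`-shatters the (finite) index set `A`. -/
def fatShatters {n : ℕ} (K : Set (Fin n → ℝ)) (t : ℝ) (A : Finset (Fin n)) : Prop :=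
  ∃ h : Fin n → ℝ, ∀ S : Finset (Fin n), S ⊆ A →
    ∃ θ ∈ K, (∀ i ∈ S, θ i ≤ h i) ∧ ∀ i ∈ A, i ∉ S → h i + t ≤ θ i

/-- The fat shattering dimension `v(K, t)`. -/
def fatDim {n : ℕ} (K : Set (Fin n → ℝ)) (t : ℝ) : ℕ :=
  sSup {m : ℕ | ∃ A : Finset (Fin n), A.card = m ∧ fatShatters K t A}

/-- The tangent cone of `K` at `θ`. -/
def tanCone {n : ℕ} (K : Set (Fin n → ℝ)) (θ : Fin n → ℝ) : Set (Fin n → ℝ) :=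
  closure {w | ∃ t : ℝ, 0 ≤ t ∧ ∃ η ∈ K, w = t • (η - θ)}

/-- `V_{a,b}(f) = Σ_{m=a+1}^{b} |f_m - f_{m-1}|` for the (paper 1-indexed) sequence whose
`m`-th entry is `f (m-1)`. -/
def Vab (f : ℕ → ℝ) (a b : ℕ) : ℝ := ∑ t ∈ Finset.Ico (a - 1) (b - 1), |f (t + 1) - f t|

/-- `Acoef r n v j = Σ_{i=j}^n C(r+i-j-1, r-1) v_i` (paper 1-indexed). -/
def Acoef (r n : ℕ) (v : Fin n → ℝ) (jj : ℕ) : ℝ :=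
  ∑ i : Fin n, (if jj ≤ i.1 + 1 then ((r + (i.1 + 1) - jj - 1).choose (r - 1) : ℝ) else 0) * v i

/-- The class `C_r({a_i}, {s_i})`. -/
def Cras (r n : ℕ) (a s : ℕ → ℝ) : Set (Fin n → ℝ) :=
  {θ | (∀ i < r - 1, a i ≤ DD i θ 0 ∧ DD i θ 0 ≤ a i + s i) ∧
    a (r - 1) ≤ DD (r - 1) θ 0 ∧
    (∀ t : ℕ, t + 1 ≤ n - r → DD (r - 1) θ t ≤ DD (r - 1) θ (t + 1)) ∧
    DD (r - 1) θ (n - r) ≤ a (r - 1) + s (r - 1)}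

/-- The class `C_r(a, V) = {θ : a ≤ (D^{(r-1)}θ)_1 ≤ ⋯ ≤ (D^{(r-1)}θ)_{n-r+1} ≤ a + V}`. -/
def CrMono (r n : ℕ) (a V : ℝ) : Set (Fin n → ℝ) :=
  {θ | a ≤ DD (r - 1) θ 0 ∧
    (∀ t : ℕ, t + 1 ≤ n - r → DD (r - 1) θ t ≤ DD (r - 1) θ (t + 1)) ∧
    DD (r - 1) θ (n - r) ≤ a + V}


section
open MeasureTheory ProbabilityTheory
open scoped BigOperators
noncomputable section

lemma a1_exists (n : ℕ) (z lo hi : ℕ → ℝ) (h : ∀ s, lo s ≤ hi s) :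
    ∃ W : ℕ → ℝ, (∀ s, lo s ≤ W s ∧ W s ≤ hi s) ∧
      ∀ W' : ℕ → ℝ, (∀ s, lo s ≤ W' s ∧ W' s ≤ hi s) →
        ∑ t ∈ Finset.range n, (z t - W t + W (t+1))^2 ≤
          ∑ t ∈ Finset.range n, (z t - W' t + W' (t+1))^2 := by
  have hc : IsCompact (Set.Icc lo hi) := isCompact_Icc
  have hne : (Set.Icc lo hi).Nonempty := ⟨lo, le_refl _, h⟩
  have hcont : Continuous (fun W : ℕ → ℝ => ∑ t ∈ Finset.range n, (z t - W t + W (t+1))^2) := by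
    fun_prop
  obtain ⟨W, hW, hmin⟩ := hc.exists_isMinOn hne hcont.continuousOn
  refine ⟨W, fun s => ⟨hW.1 s, hW.2 s⟩, fun W' hW' => ?_⟩
  exact hmin (show W' ∈ Set.Icc lo hi from ⟨fun s => (hW' s).1, fun s => (hW' s).2⟩)

lemma a1_pert (n : ℕ) (z W : ℕ → ℝ) (s : ℕ) (hs : s + 1 < n) (e : ℝ) :
    ∑ t ∈ Finset.range n, (z t - Function.update W (s+1) (W (s+1) + e) t
        + Function.update W (s+1) (W (s+1) + e) (t+1))^2
      = ∑ t ∈ Finset.range n, (z t - W t + W (t+1))^2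
        + 2 * e * ((z s - W s + W (s+1)) - (z (s+1) - W (s+1) + W (s+2))) + 2 * e^2 := by
  have : ∑ t ∈ Finset.range n, ((z t - Function.update W (s+1) (W (s+1) + e) t
        + Function.update W (s+1) (W (s+1) + e) (t+1))^2 - (z t - W t + W (t+1))^2)
      = ∑ t ∈ ({s, s+1} : Finset ℕ), ((z t - Function.update W (s+1) (W (s+1) + e) t
        + Function.update W (s+1) (W (s+1) + e) (t+1))^2 - (z t - W t + W (t+1))^2) := by
    symm
    apply Finset.sum_subset
    · intro t ht
      simp at ht ⊢
      omega
    · intro t _ ht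
      simp at ht
      rw [Function.update_of_ne (by omega), Function.update_of_ne (by omega)]
      ring
  rw [Finset.sum_sub_distrib, Finset.sum_pair (by omega)] at this
  rw [Function.update_self, Function.update_of_ne (by omega : s ≠ s+1),
    Function.update_of_ne (by omega : s + 1 + 1 ≠ s+1)] at this
  linarith

lemma a1_kkt (n : ℕ) (z lo hi : ℕ → ℝ) (h : ∀ s, lo s ≤ hi s) :
    ∃ W : ℕ → ℝ, (∀ s, lo s ≤ W s ∧ W s ≤ hi s) ∧
      ∀ s, s + 1 < n →
        ((z s - W s + W (s+1)) < (z (s+1) - W (s+1) + W (s+2)) → W (s+1) = hi (s+1)) ∧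
        ((z (s+1) - W (s+1) + W (s+2)) < (z s - W s + W (s+1)) → W (s+1) = lo (s+1)) := by
  obtain ⟨W, hW, hmin⟩ := a1_exists n z lo hi h
  refine ⟨W, hW, fun s hs => ?_⟩
  have key : ∀ e : ℝ, lo (s+1) ≤ W (s+1) + e → W (s+1) + e ≤ hi (s+1) →
      0 ≤ 2 * e * ((z s - W s + W (s+1)) - (z (s+1) - W (s+1) + W (s+2))) + 2 * e^2 := by
    intro e h1 h2
    have := hmin (Function.update W (s+1) (W (s+1) + e)) (by
      intro t
      by_cases ht : t = s + 1
      · subst ht; simp [h1, h2]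
      · rw [Function.update_of_ne ht]; exact hW t)
    rw [a1_pert n z W s hs e] at this
    linarith
  generalize (z s - W s + W (s+1)) = a at *
  generalize (z (s+1) - W (s+1) + W (s+2)) = b at *
  obtain ⟨hl, hu⟩ := hW (s+1)
  constructor
  · intro hab
    by_contra hne
    have hlt : W (s+1) < hi (s+1) := lt_of_le_of_ne hu hne
    set e := min (hi (s+1) - W (s+1)) ((b - a)/2) with he
    have e0 : 0 < e := lt_min (by linarith) (by linarith)
    have e1 : e ≤ hi (s+1) - W (s+1) := min_le_left _ _
    have e2 : e ≤ (b-a)/2 := min_le_right _ _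
    have := key e (by linarith) (by linarith)
    nlinarith
  · intro hab
    by_contra hne
    have hlt : lo (s+1) < W (s+1) := lt_of_le_of_ne hl (Ne.symm hne)
    set e := min (W (s+1) - lo (s+1)) ((a - b)/2) with he
    have e0 : 0 < e := lt_min (by linarith) (by linarith)
    have e1 : e ≤ W (s+1) - lo (s+1) := min_le_left _ _
    have e2 : e ≤ (a-b)/2 := min_le_right _ _
    have := key (-e) (by linarith) (by linarith)
    nlinarith

lemma a2_right (w W : ℕ → ℝ) (lam : ℝ) (t q : ℕ) (htq : t < q)
    (hdrop : ∀ s, t ≤ s → s + 1 < q → w (s+1) < w s → W (s+1) = -lam) :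
    ∃ u, t < u ∧ u ≤ q ∧ (∀ i, t ≤ i → i < u → w t ≤ w i) ∧ (u = q ∨ W u = -lam) := by
  classical
  have hex : ∃ u, t < u ∧ (u = q ∨ w u < w t) := ⟨q, htq, Or.inl rfl⟩
  have hs := Nat.find_spec hex
  have hm := fun m => @Nat.find_min _ _ hex m
  have hle : Nat.find hex ≤ q := Nat.find_min' hex ⟨htq, Or.inl rfl⟩
  set u := Nat.find hex with hu
  have hall : ∀ i, t ≤ i → i < u → w t ≤ w i := by
    intro i hi hiu
    rcases eq_or_lt_of_le hi with rfl | hi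
    · exact le_refl _
    · have := hm i hiu
      by_contra hc
      exact this ⟨hi, Or.inr (not_le.mp hc)⟩
  refine ⟨u, hs.1, hle, hall, ?_⟩
  by_cases huq : u = q
  · exact Or.inl huq
  · right
    have hlt : w u < w t := hs.2.resolve_left huq
    obtain ⟨s, hsu⟩ : ∃ s, u = s + 1 := ⟨u - 1, by omega⟩
    rw [hsu] at hlt ⊢
    apply hdrop s (by omega) (by omega)
    exact lt_of_lt_of_le hlt (hall s (by omega) (by omega))

lemma a2_left (w W : ℕ → ℝ) (lam : ℝ) (p t : ℕ) (hpt : p ≤ t)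
    (hrise : ∀ s, p ≤ s → s + 1 ≤ t → w s < w (s+1) → W (s+1) = lam) :
    ∃ s, p ≤ s ∧ s ≤ t ∧ (∀ i, s ≤ i → i ≤ t → w t ≤ w i) ∧ (s = p ∨ W s = lam) := by
  classical
  have hex : ∃ d, d ≤ t - p ∧ (d = t - p ∨ w (t - d - 1) < w t) := ⟨t - p, le_refl _, Or.inl rfl⟩
  have hs := Nat.find_spec hex
  have hm := fun m => @Nat.find_min _ _ hex m
  set d := Nat.find hex with hd
  have hall : ∀ i, t - d ≤ i → i ≤ t → w t ≤ w i := by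
    intro i hi hit
    rcases eq_or_lt_of_le hit with rfl | hit
    · exact le_refl _
    · have := hm (t - i - 1) (by omega)
      by_contra hc
      apply this
      refine ⟨by omega, Or.inr ?_⟩
      have : t - (t - i - 1) - 1 = i := by omega
      rw [this]; exact not_le.mp hc
  refine ⟨t - d, by omega, by omega, hall, ?_⟩
  by_cases hdp : d = t - p
  · left; omega
  · right
    have hlt := hs.2.resolve_left hdp
    obtain ⟨s, hsu⟩ : ∃ s, t - d = s + 1 := ⟨t - d - 1, by omega⟩
    have h1 : t - d - 1 = s := by omega
    rw [h1] at hlt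
    rw [hsu]
    apply hrise s (by omega) (by omega)
    exact lt_of_lt_of_le hlt (hall (s+1) (by omega) (by omega))

lemma a3_pos (w W z : ℕ → ℝ) (lam : ℝ) (p t q : ℕ) (hpt : p ≤ t) (htq : t < q)
    (hw : ∀ s, w s = z s - W s + W (s+1))
    (hlam : 0 ≤ lam)
    (hWb : ∀ s, p ≤ s → s ≤ q → |W s| ≤ lam)
    (hrise : ∀ s, p ≤ s → s + 1 < q → w s < w (s+1) → W (s+1) = lam)
    (hdrop : ∀ s, p ≤ s → s + 1 < q → w (s+1) < w s → W (s+1) = -lam)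
    (R R' E d : ℝ) (hR0 : 0 ≤ R) (hR'0 : 0 ≤ R') (hE0 : 0 ≤ E)
    (hR : ∀ u, t < u → u ≤ q → (∑ i ∈ Finset.Ico p u, z i)^2 ≤ ((u:ℝ) - p)^2 * R)
    (hR' : ∀ s, p ≤ s → s ≤ t → (∑ i ∈ Finset.Ico s q, z i)^2 ≤ ((q:ℝ) - s)^2 * R')
    (hE : ∀ s u, p ≤ s → s ≤ t → t < u → u ≤ q →
      (max (|∑ i ∈ Finset.Ico s u, z i| - 2 * lam) 0)^2 ≤ E)
    (hd : |W q - W p| ≤ ((q:ℝ) - p) * d) (hpos : 0 ≤ w t) :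
    (w t)^2 ≤ 2 * R + R' + 2 * d^2 + E := by
  obtain ⟨u, htu, huq, hur, hu⟩ := a2_right w W lam t q htq
    (fun s h1 h2 => hdrop s (by omega) h2)
  obtain ⟨s, hps, hst, hsl, hs⟩ := a2_left w W lam p t hpt
    (fun s h1 h2 => hrise s (by omega) (by omega))
  have hsum : ∑ i ∈ Finset.Ico s u, w i = ∑ i ∈ Finset.Ico s u, z i - W s + W u := by
    have : ∑ i ∈ Finset.Ico s u, (W (i+1) - W i) = W u - W s :=
      Finset.sum_Ico_sub W (by omega)
    calc ∑ i ∈ Finset.Ico s u, w i = ∑ i ∈ Finset.Ico s u, (z i + (W (i+1) - W i)) := by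
          apply Finset.sum_congr rfl; intro i _; rw [hw]; ring
      _ = _ := by rw [Finset.sum_add_distrib, this]; ring
  have hlow : ((u:ℝ) - s) * w t ≤ ∑ i ∈ Finset.Ico s u, w i := by
    have := Finset.card_nsmul_le_sum (Finset.Ico s u) w (w t) (by
      intro i hi
      rw [Finset.mem_Ico] at hi
      rcases le_or_gt i t with h | h
      · exact hsl i hi.1 h
      · exact hur i h.le hi.2)
    rw [Nat.card_Ico, nsmul_eq_mul, Nat.cast_sub (by omega)] at this
    exact this
  rw [hsum] at hlow
  have hlen : (1:ℝ) ≤ (u:ℝ) - s := by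
    have : (s:ℝ) + 1 ≤ u := by exact_mod_cast (by omega : s + 1 ≤ u)
    linarith
  have hWs := abs_le.mp (hWb s hps (by omega))
  have hWu := abs_le.mp (hWb u (by omega) huq)
  have h0 : 0 ≤ ((u:ℝ) - s) * w t := by positivity
  have hd2 : 0 ≤ d^2 := sq_nonneg d
  rcases hs with hs | hs <;> rcases hu with hu | hu
  · -- whole
    subst hs; subst hu
    have hRR := hR u htu le_rfl
    set S := ∑ i ∈ Finset.Ico s u, z i
    have h3 : ((u:ℝ) - s) * w t ≤ |S| + ((u:ℝ) - s) * d := by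
      have := le_abs_self S
      have := le_abs_self (W u - W s)
      linarith
    have h4 : (((u:ℝ) - s) * w t)^2 ≤ (|S| + ((u:ℝ) - s) * d)^2 := by
      apply pow_le_pow_left₀ h0 h3
    have h5 : (|S| + ((u:ℝ) - s) * d)^2 ≤ 2 * S^2 + 2 * (((u:ℝ) - s) * d)^2 := by
      have := sq_nonneg (|S| - ((u:ℝ) - s) * d)
      have := sq_abs S
      nlinarith
    have h6 : ((u:ℝ) - s)^2 * (w t)^2 ≤ ((u:ℝ) - s)^2 * (2 * R + 2 * d^2) := by nlinarith
    have := le_of_mul_le_mul_left h6 (by positivity)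
    linarith
  · subst hs
    have hRR := hR u htu huq
    set S := ∑ i ∈ Finset.Ico s u, z i
    have h3 : ((u:ℝ) - s) * w t ≤ S := by linarith
    have h4 := pow_le_pow_left₀ h0 h3 2
    have h6 : ((u:ℝ) - s)^2 * (w t)^2 ≤ ((u:ℝ) - s)^2 * R := by nlinarith
    have := le_of_mul_le_mul_left h6 (by positivity)
    linarith
  · subst hu
    have hRR := hR' s hps hst
    set S := ∑ i ∈ Finset.Ico s u, z i
    have h3 : ((u:ℝ) - s) * w t ≤ S := by linarith
    have h4 := pow_le_pow_left₀ h0 h3 2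
    have h6 : ((u:ℝ) - s)^2 * (w t)^2 ≤ ((u:ℝ) - s)^2 * R' := by nlinarith
    have := le_of_mul_le_mul_left h6 (by positivity)
    linarith
  · have hEE := hE s u hps hst htu huq
    set S := ∑ i ∈ Finset.Ico s u, z i
    have h3 : w t ≤ max (|S| - 2 * lam) 0 := by
      refine le_trans ?_ (le_max_left _ _)
      have := le_abs_self S
      nlinarith
    have h4 := pow_le_pow_left₀ hpos h3 2
    linarith

lemma a3 (w W z : ℕ → ℝ) (lam : ℝ) (p t q : ℕ) (hpt : p ≤ t) (htq : t < q)
    (hw : ∀ s, w s = z s - W s + W (s+1))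
    (hlam : 0 ≤ lam)
    (hWb : ∀ s, p ≤ s → s ≤ q → |W s| ≤ lam)
    (hrise : ∀ s, p ≤ s → s + 1 < q → w s < w (s+1) → W (s+1) = lam)
    (hdrop : ∀ s, p ≤ s → s + 1 < q → w (s+1) < w s → W (s+1) = -lam)
    (R R' E d : ℝ) (hR0 : 0 ≤ R) (hR'0 : 0 ≤ R') (hE0 : 0 ≤ E)
    (hR : ∀ u, t < u → u ≤ q → (∑ i ∈ Finset.Ico p u, z i)^2 ≤ ((u:ℝ) - p)^2 * R)
    (hR' : ∀ s, p ≤ s → s ≤ t → (∑ i ∈ Finset.Ico s q, z i)^2 ≤ ((q:ℝ) - s)^2 * R')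
    (hE : ∀ s u, p ≤ s → s ≤ t → t < u → u ≤ q →
      (max (|∑ i ∈ Finset.Ico s u, z i| - 2 * lam) 0)^2 ≤ E)
    (hd : |W q - W p| ≤ ((q:ℝ) - p) * d) :
    (w t)^2 ≤ 2 * R + R' + 2 * d^2 + E := by
  rcases le_total 0 (w t) with h | h
  · exact a3_pos w W z lam p t q hpt htq hw hlam hWb hrise hdrop R R' E d hR0 hR'0 hE0 hR hR' hE hd h
  · have := a3_pos (fun s => - w s) (fun s => - W s) (fun s => - z s) lam p t q hpt htq
      (fun s => by simp only [hw]; ring) hlam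
      (fun s h1 h2 => by simpa using hWb s h1 h2)
      (fun s h1 h2 h3 => by rw [hdrop s h1 h2 (by linarith)]; ring)
      (fun s h1 h2 h3 => by rw [hrise s h1 h2 (by linarith)])
      R R' E d hR0 hR'0 hE0
      (fun u h1 h2 => by simpa [Finset.sum_neg_distrib] using hR u h1 h2)
      (fun u h1 h2 => by simpa [Finset.sum_neg_distrib] using hR' u h1 h2)
      (fun s u h1 h2 h3 h4 => by simpa [Finset.sum_neg_distrib] using hE s u h1 h2 h3 h4)
      (by rw [← abs_neg]; convert hd using 2; ring)
      (by simpa using h)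
    simpa using this
end
end

section
open MeasureTheory ProbabilityTheory
open scoped BigOperators
noncomputable section

/-- Running maximum of the partial sums (started at zero). -/
def runMax {Ω : Type*} (x : ℕ → Ω → ℝ) : ℕ → Ω → ℝ
  | 0 => fun _ => 0
  | (i+1) => fun ω => max (runMax x i ω) (∑ l ∈ Finset.range (i+1), x l ω)

lemma runMax_nonneg {Ω : Type*} (x : ℕ → Ω → ℝ) (i : ℕ) (ω : Ω) : 0 ≤ runMax x i ω := by
  induction i with
  | zero => simp [runMax]
  | succ i ih => exact le_trans ih (le_max_left _ _)

lemma le_runMax {Ω : Type*} (x : ℕ → Ω → ℝ) (N j : ℕ) (h : j ≤ N) (ω : Ω) :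
    ∑ l ∈ Finset.range j, x l ω ≤ runMax x N ω := by
  induction N with
  | zero => obtain rfl : j = 0 := by omega
            simp [runMax]
  | succ i ih =>
    rcases eq_or_lt_of_le h with rfl | h
    · exact le_max_right _ _
    · exact le_trans (ih (by omega)) (le_max_left _ _)

lemma runMax_path {Ω : Type*} (x : ℕ → Ω → ℝ) (N : ℕ) (ω : Ω) :
    1/2 * (runMax x N ω)^2 ≤ runMax x N ω * (∑ l ∈ Finset.range N, x l ω)
      - ∑ i ∈ Finset.range N, runMax x i ω * x i ω := by
  induction N with
  | zero => simp [runMax]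
  | succ N ih =>
    rw [Finset.sum_range_succ (fun i => runMax x i ω * x i ω)]
    have hS := Finset.sum_range_succ (fun i => x i ω) N
    have hdef : runMax x (N+1) ω = max (runMax x N ω) (∑ l ∈ Finset.range (N+1), x l ω) := rfl
    set S' := ∑ l ∈ Finset.range (N+1), x l ω
    set S := ∑ l ∈ Finset.range N, x l ω
    have hx : x N ω = S' - S := by linarith
    rw [hx]
    rcases le_total (runMax x N ω) S' with h | h
    · rw [hdef, max_eq_right h]
      nlinarith [sq_nonneg (S' - runMax x N ω)]
    · rw [hdef, max_eq_left h]
      nlinarith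

lemma runMax_congr {Ω : Type*} (x : ℕ → Ω → ℝ) (N : ℕ) (ω ω' : Ω)
    (h : ∀ j < N, x j ω = x j ω') : runMax x N ω = runMax x N ω' := by
  induction N with
  | zero => rfl
  | succ N ih =>
    simp only [runMax]
    rw [ih (fun j hj => h j (by omega))]
    congr 1
    apply Finset.sum_congr rfl
    intro l hl
    exact h l (by simpa using hl)

variable {Ω : Type*} [MeasurableSpace Ω]

lemma memLp_max {μ : Measure Ω} {f g : Ω → ℝ} (hf : MemLp f 2 μ) (hg : MemLp g 2 μ) :
    MemLp (fun ω => max (f ω) (g ω)) 2 μ := hf.sup hg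

lemma runMax_memLp {μ : Measure Ω} (x : ℕ → Ω → ℝ) (h2 : ∀ i, MemLp (x i) 2 μ) (N : ℕ) :
    MemLp (runMax x N) 2 μ := by
  induction N with
  | zero => exact MemLp.zero
  | succ N ih => exact memLp_max ih (memLp_finsetSum _ (fun i _ => h2 i))

lemma flip_zero {μ : Measure Ω} (f g : Ω → ℝ) (hf : AEStronglyMeasurable (fun ω => f ω * g ω) μ)
    (T : Ω → Ω) (hT : MeasurePreserving T μ μ) (h1 : ∀ ω, f (T ω) = f ω) (h2 : ∀ ω, g (T ω) = - g ω) :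
    ∫ ω, f ω * g ω ∂μ = 0 := by
  have h : ∫ ω, f (T ω) * g (T ω) ∂μ = ∫ ω, f ω * g ω ∂μ := by
    have := integral_map (f := fun ω => f ω * g ω) hT.measurable.aemeasurable (by rwa [hT.map_eq])
    rw [hT.map_eq] at this
    exact this.symm
  simp only [h1, h2, mul_neg, integral_neg] at h
  linarith

lemma doob_one {μ : Measure Ω} [IsProbabilityMeasure μ] (x : ℕ → Ω → ℝ)
    (h2 : ∀ i, MemLp (x i) 2 μ) (hv : ∀ i, ∫ ω, (x i ω)^2 ∂μ ≤ 1)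
    (hflip : ∀ i, ∃ T : Ω → Ω, MeasurePreserving T μ μ ∧ (∀ ω, x i (T ω) = - x i ω) ∧
      ∀ j < i, ∀ ω, x j (T ω) = x j ω) (N : ℕ) :
    ∫ ω, (runMax x N ω)^2 ∂μ ≤ 4 * N := by
  have hSm : ∀ N, MemLp (fun ω => ∑ l ∈ Finset.range N, x l ω) 2 μ :=
    fun N => memLp_finsetSum _ (fun i _ => h2 i)
  have hS : ∀ N : ℕ, ∫ ω, (∑ l ∈ Finset.range N, x l ω)^2 ∂μ ≤ N := by
    intro N
    induction N with
    | zero => simp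
    | succ N ih =>
      have hz : ∫ ω, (∑ l ∈ Finset.range N, x l ω) * x N ω ∂μ = 0 := by
        obtain ⟨T, hT, h1, h3⟩ := hflip N
        refine flip_zero (fun ω => ∑ l ∈ Finset.range N, x l ω) (x N)
          ((hSm N).integrable_mul (h2 N)).aestronglyMeasurable T hT ?_ h1
        intro ω
        exact Finset.sum_congr rfl (fun l hl => h3 l (by simpa using hl) ω)
      have : ∀ ω, (∑ l ∈ Finset.range (N+1), x l ω)^2 = (∑ l ∈ Finset.range N, x l ω)^2
          + 2 * ((∑ l ∈ Finset.range N, x l ω) * x N ω) + (x N ω)^2 := by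
        intro ω; rw [Finset.sum_range_succ]; ring
      simp only [this]
      have i1 := (hSm N).integrable_sq
      have i2 : Integrable (fun ω => 2 * ((∑ l ∈ Finset.range N, x l ω) * x N ω)) μ :=
        ((hSm N).integrable_mul (h2 N)).const_mul 2
      have i12 : Integrable (fun ω => (∑ l ∈ Finset.range N, x l ω)^2
          + 2 * ((∑ l ∈ Finset.range N, x l ω) * x N ω)) μ := i1.add i2
      rw [integral_add i12 (h2 N).integrable_sq, integral_add i1 i2,
        integral_const_mul, hz]
      have := hv N
      push_cast
      linarith
  have hM := runMax_memLp x h2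
  have hz : ∀ i, ∫ ω, runMax x i ω * x i ω ∂μ = 0 := by
    intro i
    obtain ⟨T, hT, h1, h3⟩ := hflip i
    refine flip_zero (runMax x i) (x i) ((hM i).integrable_mul (h2 i)).aestronglyMeasurable T hT ?_ h1
    intro ω
    exact runMax_congr x i _ _ (fun j hj => h3 j hj ω)
  have hpt : ∀ ω, (runMax x N ω)^2 ≤ 4 * (∑ l ∈ Finset.range N, x l ω)^2
      - 4 * ∑ i ∈ Finset.range N, runMax x i ω * x i ω := by
    intro ω
    have := runMax_path x N ω
    nlinarith [sq_nonneg (runMax x N ω - 2 * ∑ l ∈ Finset.range N, x l ω)]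
  have i1 : Integrable (fun ω => 4 * (∑ l ∈ Finset.range N, x l ω)^2) μ :=
    (hSm N).integrable_sq.const_mul 4
  have i3 : ∀ i ∈ Finset.range N, Integrable (fun ω => runMax x i ω * x i ω) μ :=
    fun i _ => (hM i).integrable_mul (h2 i)
  have i2 : Integrable (fun ω => 4 * ∑ i ∈ Finset.range N, runMax x i ω * x i ω) μ :=
    (integrable_finsetSum _ i3).const_mul 4
  calc ∫ ω, (runMax x N ω)^2 ∂μ ≤ ∫ ω, (4 * (∑ l ∈ Finset.range N, x l ω)^2
      - 4 * ∑ i ∈ Finset.range N, runMax x i ω * x i ω) ∂μ :=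
        integral_mono (hM N).integrable_sq (i1.sub i2) hpt
    _ = 4 * ∫ ω, (∑ l ∈ Finset.range N, x l ω)^2 ∂μ := by
        rw [integral_sub i1 i2, integral_const_mul, integral_const_mul, integral_finsetSum _ i3]
        simp [hz]
    _ ≤ 4 * N := by linarith [hS N]

lemma doob_two {μ : Measure Ω} [IsProbabilityMeasure μ] (x : ℕ → Ω → ℝ)
    (h2 : ∀ i, MemLp (x i) 2 μ) (hv : ∀ i, ∫ ω, (x i ω)^2 ∂μ ≤ 1)
    (hflip : ∀ i, ∃ T : Ω → Ω, MeasurePreserving T μ μ ∧ (∀ ω, x i (T ω) = - x i ω) ∧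
      ∀ j < i, ∀ ω, x j (T ω) = x j ω) (N : ℕ) :
    ∃ D : Ω → ℝ, Integrable D μ ∧ (∀ ω, 0 ≤ D ω) ∧
      (∀ ω j, j ≤ N → (∑ l ∈ Finset.range j, x l ω)^2 ≤ D ω) ∧ ∫ ω, D ω ∂μ ≤ 8 * N := by
  have h2' : ∀ i, MemLp (fun ω => - x i ω) 2 μ := fun i => (h2 i).neg
  have d1 := doob_one x h2 hv hflip N
  have d2 := doob_one (fun i ω => - x i ω) h2' (by simpa using hv) (by
    intro i
    obtain ⟨T, hT, h1, h3⟩ := hflip i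
    exact ⟨T, hT, fun ω => by rw [h1], fun j hj ω => by rw [h3 j hj]⟩) N
  have i1 := (runMax_memLp x h2 N).integrable_sq
  have i2 := (runMax_memLp (fun i ω => - x i ω) h2' N).integrable_sq
  refine ⟨fun ω => (runMax x N ω)^2 + (runMax (fun i ω => - x i ω) N ω)^2, i1.add i2,
    fun ω => by positivity, fun ω j hj => ?_, ?_⟩
  · have a1 := le_runMax x N j hj ω
    have a2 := le_runMax (fun i ω => - x i ω) N j hj ω
    have a3 := runMax_nonneg x N ω
    have a4 := runMax_nonneg (fun i ω => - x i ω) N ω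
    rw [Finset.sum_neg_distrib] at a2
    rcases le_total 0 (∑ l ∈ Finset.range j, x l ω) with h | h <;> nlinarith
  · rw [integral_add i1 i2]; linarith

lemma hajek {μ : Measure Ω} [IsProbabilityMeasure μ] (x : ℕ → Ω → ℝ)
    (h2 : ∀ i, MemLp (x i) 2 μ) (hv : ∀ i, ∫ ω, (x i ω)^2 ∂μ ≤ 1)
    (hflip : ∀ i, ∃ T : Ω → Ω, MeasurePreserving T μ μ ∧ (∀ ω, x i (T ω) = - x i ω) ∧
      ∀ j < i, ∀ ω, x j (T ω) = x j ω) (n a : ℕ) (ha : 1 ≤ a) :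
    ∃ R : Ω → ℝ, Integrable R μ ∧ (∀ ω, 0 ≤ R ω) ∧
      (∀ ω j, a ≤ j → j ≤ n → (∑ l ∈ Finset.range j, x l ω)^2 ≤ (j:ℝ)^2 * R ω) ∧
      ∫ ω, R ω ∂μ ≤ 32 / a := by
  choose D hDi hD0 hDs hDint using doob_two x h2 hv hflip
  have ha' : (0:ℝ) < a := by exact_mod_cast ha
  have hii : ∀ l ∈ Finset.range (n+1),
      Integrable (fun ω => D (2^(l+1)*a) ω / ((2:ℝ)^l * a)^2) μ := fun l _ => (hDi _).div_const _
  refine ⟨fun ω => ∑ l ∈ Finset.range (n+1), D (2^(l+1)*a) ω / ((2:ℝ)^l * a)^2,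
    integrable_finsetSum _ hii, fun ω => Finset.sum_nonneg fun l _ => ?_, fun ω j haj hjn => ?_, ?_⟩
  · exact div_nonneg (hD0 _ _) (by positivity)
  · -- dyadic scale
    have hne : j / a ≠ 0 := by
      have := Nat.div_pos haj ha; omega
    set l := Nat.log 2 (j / a) with hl
    have l1 : 2^l ≤ j / a := Nat.pow_log_le_self 2 hne
    have l2 : j / a < 2^(l+1) := Nat.lt_pow_succ_log_self (by norm_num) _
    have l3 : 2^l * a ≤ j := le_trans (Nat.mul_le_mul_right a l1) (Nat.div_mul_le_self j a)
    have l4 : j ≤ 2^(l+1) * a := ((Nat.div_lt_iff_lt_mul ha).mp l2).le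
    have l5 : l < n + 1 := by
      have h1 : l < 2^l := Nat.lt_two_pow_self
      have h2 : 2^l * 1 ≤ 2^l*a := Nat.mul_le_mul_left _ ha
      omega
    have hterm : D (2^(l+1)*a) ω / ((2:ℝ)^l * a)^2 ≤
        ∑ l ∈ Finset.range (n+1), D (2^(l+1)*a) ω / ((2:ℝ)^l * a)^2 :=
      Finset.single_le_sum (f := fun l => D (2^(l+1)*a) ω / ((2:ℝ)^l * a)^2)
        (fun l _ => div_nonneg (hD0 _ _) (by positivity)) (Finset.mem_range.mpr l5)
    have hDD := hDs (2^(l+1)*a) ω j l4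
    have l3' : (2:ℝ)^l * a ≤ j := by exact_mod_cast l3
    have hpos : (0:ℝ) < (2:ℝ)^l * a := by positivity
    calc (∑ l ∈ Finset.range j, x l ω)^2 ≤ D (2^(l+1)*a) ω := hDD
      _ = ((2:ℝ)^l * a)^2 * (D (2^(l+1)*a) ω / ((2:ℝ)^l * a)^2) := by field_simp
      _ ≤ (j:ℝ)^2 * (D (2^(l+1)*a) ω / ((2:ℝ)^l * a)^2) := by
          apply mul_le_mul_of_nonneg_right _ (div_nonneg (hD0 _ _) (by positivity))
          exact pow_le_pow_left₀ hpos.le l3' 2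
      _ ≤ _ := by apply mul_le_mul_of_nonneg_left hterm (by positivity)
  · rw [integral_finsetSum _ hii]
    calc ∑ l ∈ Finset.range (n+1), ∫ ω, D (2^(l+1)*a) ω / ((2:ℝ)^l * a)^2 ∂μ
        ≤ ∑ l ∈ Finset.range (n+1), 16 / a * (1/2:ℝ)^l := by
          apply Finset.sum_le_sum
          intro l _
          rw [integral_div]
          have := hDint (2^(l+1)*a)
          push_cast at this
          rw [div_le_iff₀ (by positivity)]
          refine this.trans (le_of_eq ?_)
          rw [div_pow, one_pow, pow_succ]
          field_simp
          ring
      _ ≤ 32 / a := by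
          rw [← Finset.mul_sum]
          have : ∑ l ∈ Finset.range (n+1), (1/2:ℝ)^l ≤ 2 := sum_geometric_two_le _
          have h16 : (0:ℝ) ≤ 16 / a := by positivity
          calc 16 / (a:ℝ) * _ ≤ 16 / a * 2 := mul_le_mul_of_nonneg_left this h16
            _ = _ := by ring
end
end

section
open MeasureTheory ProbabilityTheory
open scoped BigOperators
noncomputable section

lemma gaussVec_one (n : ℕ) : gaussVec n 1 = Measure.pi fun _ : Fin n => gaussianReal 0 1 := by
  simp [gaussVec]

instance gaussVec_prob (n : ℕ) : IsProbabilityMeasure (gaussVec n 1) := by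
  rw [gaussVec_one]; infer_instance

lemma pad_lt {n : ℕ} (z : Fin n → ℝ) (t : ℕ) (h : t < n) : pad z t = z ⟨t, h⟩ := by
  simp [pad, h]

lemma pad_ge {n : ℕ} (z : Fin n → ℝ) (t : ℕ) (h : ¬ t < n) : pad z t = 0 := by
  simp [pad, h]

lemma pad_val {n : ℕ} (z : Fin n → ℝ) (i : Fin n) : pad z i.1 = z i := by
  simp [pad]

lemma coord_memLp (n : ℕ) (i : Fin n) : MemLp (fun z : Fin n → ℝ => z i) 2 (gaussVec n 1) := by
  rw [gaussVec_one]
  exact (memLp_id_gaussianReal' (μ := 0) (v := 1) 2 (by simp)).comp_measurePreserving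
    (measurePreserving_eval (fun _ : Fin n => gaussianReal 0 1) i)

lemma coord_sq (n : ℕ) (i : Fin n) : ∫ z : Fin n → ℝ, (z i)^2 ∂(gaussVec n 1) = 1 := by
  rw [gaussVec_one]
  have h := (measurePreserving_eval (fun _ : Fin n => gaussianReal 0 1) i)
  have h1 := integral_map (μ := Measure.pi fun _ : Fin n => gaussianReal 0 1)
    (φ := Function.eval i) (f := fun x : ℝ => x^2) h.measurable.aemeasurable
    (by fun_prop)
  rw [h.map_eq] at h1
  have h2 : ∫ x, x^2 ∂(gaussianReal 0 1) = 1 := by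
    have := variance_id_gaussianReal (μ := 0) (v := 1)
    rw [variance_of_integral_eq_zero (by fun_prop) (by simp)] at this
    simpa using this
  rw [h2] at h1
  exact h1.symm

lemma pad_memLp (n t : ℕ) : MemLp (fun z : Fin n → ℝ => pad z t) 2 (gaussVec n 1) := by
  by_cases h : t < n
  · simp only [pad_lt _ t h]; exact coord_memLp n _
  · simp only [pad_ge _ t h]; exact MemLp.zero

lemma pad_sq (n t : ℕ) : ∫ z : Fin n → ℝ, (pad z t)^2 ∂(gaussVec n 1) ≤ 1 := by
  by_cases h : t < n
  · simp only [pad_lt _ t h]; rw [coord_sq]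
  · simp only [pad_ge _ t h]; simp

/-- Flip the sign of coordinate `t`. -/
def flipT (n t : ℕ) (z : Fin n → ℝ) : Fin n → ℝ := fun i => if i.1 = t then - z i else z i

lemma flipT_mp (n t : ℕ) : MeasurePreserving (flipT n t) (gaussVec n 1) (gaussVec n 1) := by
  rw [gaussVec_one]
  have := measurePreserving_pi (fun _ : Fin n => gaussianReal 0 1) (fun _ : Fin n => gaussianReal 0 1)
    (f := fun i x => if i.1 = t then - x else x) (by
      intro i
      by_cases h : i.1 = t
      · simp only [h, if_true]
        refine ⟨measurable_neg, ?_⟩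
        have := gaussianReal_map_neg (μ := 0) (v := 1)
        simpa using this
      · simp only [h, if_false]
        exact MeasurePreserving.id _)
  exact this

lemma flipT_pad_same (n t : ℕ) (z : Fin n → ℝ) : pad (flipT n t z) t = - pad z t := by
  by_cases h : t < n
  · simp [pad, flipT, h]
  · simp [pad, h]

lemma flipT_pad_ne (n t s : ℕ) (hs : s ≠ t) (z : Fin n → ℝ) : pad (flipT n t z) s = pad z s := by
  by_cases h : s < n
  · simp [pad, flipT, h, hs]
  · simp [pad, h]

lemma fwd (n p a : ℕ) (ha : 1 ≤ a) :
    ∃ R : (Fin n → ℝ) → ℝ, Integrable R (gaussVec n 1) ∧ (∀ z, 0 ≤ R z) ∧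
      (∀ z u, p + a ≤ u → u ≤ n →
        (∑ i ∈ Finset.Ico p u, pad z i)^2 ≤ ((u:ℝ) - p)^2 * R z) ∧
      ∫ z, R z ∂(gaussVec n 1) ≤ 32 / a := by
  obtain ⟨R, h1, h2, h3, h4⟩ := hajek (μ := gaussVec n 1) (fun i (z : Fin n → ℝ) => pad z (p + i))
    (fun i => pad_memLp n _) (fun i => pad_sq n _)
    (fun i => ⟨flipT n (p+i), flipT_mp n _, fun z => flipT_pad_same n _ z,
      fun j hj z => flipT_pad_ne n _ _ (by omega) z⟩) n a ha
  refine ⟨R, h1, h2, fun z u hu hun => ?_, h4⟩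
  have := h3 z (u - p) (by omega) (by omega)
  rw [Nat.cast_sub (by omega)] at this
  rw [Finset.sum_Ico_eq_sum_range]
  exact this

lemma bwd (n q b : ℕ) (hb : 1 ≤ b) (hq : q ≤ n) :
    ∃ R : (Fin n → ℝ) → ℝ, Integrable R (gaussVec n 1) ∧ (∀ z, 0 ≤ R z) ∧
      (∀ z s, s + b ≤ q →
        (∑ i ∈ Finset.Ico s q, pad z i)^2 ≤ ((q:ℝ) - s)^2 * R z) ∧
      ∫ z, R z ∂(gaussVec n 1) ≤ 32 / b := by
  obtain ⟨R, h1, h2, h3, h4⟩ := hajek (μ := gaussVec n 1)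
    (fun i (z : Fin n → ℝ) => if i < q then pad z (q - 1 - i) else 0)
    (fun i => by
      by_cases h : i < q
      · simp only [h, if_true]; exact pad_memLp n _
      · simp only [h, if_false]; exact MemLp.zero)
    (fun i => by
      by_cases h : i < q
      · simp only [h, if_true]; exact pad_sq n _
      · simp only [h, if_false]; simp)
    (fun i => by
      by_cases h : i < q
      · refine ⟨flipT n (q-1-i), flipT_mp n _, fun z => ?_, fun j hj z => ?_⟩
        · simp only [h, if_true]; exact flipT_pad_same n _ z
        · have : j < q := by omega
          simp only [this, if_true]; exact flipT_pad_ne n _ _ (by omega) z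
      · refine ⟨id, MeasurePreserving.id _, fun z => ?_, fun j hj z => rfl⟩
        simp [h]) n b hb
  refine ⟨R, h1, h2, fun z s hs => ?_, h4⟩
  have := h3 z (q - s) (by omega) (by omega)
  rw [Nat.cast_sub (by omega)] at this
  convert this using 2
  rw [Finset.sum_Ico_eq_sum_range, ← Finset.sum_range_reflect]
  apply Finset.sum_congr rfl
  intro l hl
  rw [Finset.mem_range] at hl
  rw [if_pos (by omega)]
  congr 1
  omega

lemma sum_pad_Ico (n s u : ℕ) (hu : u ≤ n) (z : Fin n → ℝ) :
    ∑ i ∈ Finset.Ico s u, pad z i = ∑ i : Fin n, (if s ≤ i.1 ∧ i.1 < u then z i else 0) := by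
  have : ∑ i : Fin n, (if s ≤ i.1 ∧ i.1 < u then z i else 0)
      = ∑ i : Fin n, (fun t : ℕ => if s ≤ t ∧ t < u then pad z t else 0) i.1 := by
    apply Finset.sum_congr rfl; intro i _; simp [pad_val]
  rw [this, Fin.sum_univ_eq_sum_range (fun t : ℕ => if s ≤ t ∧ t < u then pad z t else 0),
    ← Finset.sum_filter]
  apply Finset.sum_congr _ (fun _ _ => rfl)
  ext t; simp; omega

lemma exp_int (n s u : ℕ) (hu : u ≤ n) (a : ℝ) :
    Integrable (fun z : Fin n → ℝ => Real.exp (a * ∑ i ∈ Finset.Ico s u, pad z i)) (gaussVec n 1) ∧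
    ∫ z : Fin n → ℝ, Real.exp (a * ∑ i ∈ Finset.Ico s u, pad z i) ∂(gaussVec n 1)
      = Real.exp (a^2 * (u - s : ℕ) / 2) := by
  set c : Fin n → ℝ := fun i => if s ≤ i.1 ∧ i.1 < u then a else 0 with hc
  have h1 : ∀ z : Fin n → ℝ, Real.exp (a * ∑ i ∈ Finset.Ico s u, pad z i)
      = ∏ i, Real.exp (c i * z i) := by
    intro z
    rw [← Real.exp_sum, sum_pad_Ico n s u hu, Finset.mul_sum]
    congr 1
    apply Finset.sum_congr rfl; intro i _
    simp only [hc]; split_ifs <;> simp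
  simp only [h1]
  rw [gaussVec_one]
  constructor
  · exact Integrable.fintype_prod (f := fun i x => Real.exp (c i * x))
      (fun i => integrable_exp_mul_gaussianReal (c i))
  · rw [integral_fintype_prod_eq_prod (fun i x => Real.exp (c i * x))]
    have h2 : ∀ i, ∫ x, Real.exp (c i * x) ∂(gaussianReal 0 1) = Real.exp ((c i)^2 / 2) := by
      intro i
      have := congrFun (mgf_fun_id_gaussianReal (μ := 0) (v := 1)) (c i)
      simpa [mgf] using this
    simp only [h2]
    rw [← Real.exp_sum]
    congr 1
    have h3 := sum_pad_Ico n s u hu (fun _ => a^2 / 2)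
    have h4 : ∑ i ∈ Finset.Ico s u, pad (n := n) (fun _ => a^2 / 2) i = a^2 * (u - s : ℕ) / 2 := by
      rw [Finset.sum_congr rfl (g := fun _ => a^2/2) (by
        intro i hi
        rw [Finset.mem_Ico] at hi
        rw [pad_lt _ i (by omega)])]
      rw [Finset.sum_const, Nat.card_Ico, nsmul_eq_mul]; ring
    rw [← h4, h3]
    apply Finset.sum_congr rfl; intro i _
    simp only [hc]; split_ifs <;> simp

lemma expE (n s u M : ℕ) (hu : u ≤ n) (hM : u - s ≤ M) (a lam : ℝ) (ha : 0 < a) :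
    ∃ E : (Fin n → ℝ) → ℝ, Integrable E (gaussVec n 1) ∧ (∀ z, 0 ≤ E z) ∧
      (∀ z, (max (|∑ i ∈ Finset.Ico s u, pad z i| - 2 * lam) 0)^2 ≤ E z) ∧
      ∫ z, E z ∂(gaussVec n 1) ≤ 4 / a^2 * Real.exp (a^2 * M / 2 - 2 * a * lam) := by
  obtain ⟨i1, e1⟩ := exp_int n s u hu a
  obtain ⟨i2, e2⟩ := exp_int n s u hu (-a)
  refine ⟨fun z => 2 / a^2 * Real.exp (-2 * a * lam) *
    (Real.exp (a * ∑ i ∈ Finset.Ico s u, pad z i) + Real.exp (-a * ∑ i ∈ Finset.Ico s u, pad z i)),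
    (i1.add i2).const_mul _, fun z => by positivity, fun z => ?_, ?_⟩
  · set S := ∑ i ∈ Finset.Ico s u, pad z i
    have hx : ∀ y : ℝ, (max y 0)^2 ≤ 2 / a^2 * Real.exp (a * y) := by
      intro y
      rcases le_total y 0 with h | h
      · have h0 : (0:ℝ) ≤ 2 / a^2 * Real.exp (a * y) := by positivity
        rw [max_eq_right h]; simpa using h0
      · rw [max_eq_left h]
        have := Real.quadratic_le_exp_of_nonneg (x := a * y) (by positivity)
        have h2 : (a*y)^2 ≤ 2 * Real.exp (a * y) := by
          have : 0 ≤ a * y := by positivity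
          linarith
        rw [div_mul_eq_mul_div, le_div_iff₀ (by positivity)]
        nlinarith
    refine (hx _).trans ?_
    have h3 : Real.exp (a * (|S| - 2 * lam)) = Real.exp (-2*a*lam) * Real.exp (a * |S|) := by
      rw [← Real.exp_add]; congr 1; ring
    rw [h3, ← mul_assoc]
    apply mul_le_mul_of_nonneg_left _ (by positivity)
    have p1 := Real.exp_pos (a * S)
    have p2 := Real.exp_pos (-a * S)
    rcases abs_cases S with ⟨h, _⟩ | ⟨h, _⟩
    · rw [h]; linarith
    · rw [h]
      have : a * -S = -a * S := by ring
      rw [this]; linarith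
  · rw [integral_const_mul, integral_add i1 i2, e1, e2]
    have hMr : ((u - s : ℕ) : ℝ) ≤ M := by exact_mod_cast hM
    have h5 : Real.exp (a^2 * (u - s : ℕ) / 2) ≤ Real.exp (a^2 * M / 2) := by
      apply Real.exp_le_exp.mpr
      have : 0 ≤ a^2 := sq_nonneg a
      nlinarith
    rw [neg_sq, sub_eq_add_neg, Real.exp_add]
    have h6 : -(2 * a * lam) = -2 * a * lam := by ring
    rw [h6]
    have h7 : 0 ≤ 4 / a^2 * Real.exp (-2 * a * lam) := by positivity
    calc _ = 4 / a^2 * Real.exp (-2 * a * lam) * Real.exp (a^2 * (u - s : ℕ) / 2) := by ring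
      _ ≤ 4 / a^2 * Real.exp (-2 * a * lam) * Real.exp (a^2 * M / 2) :=
        mul_le_mul_of_nonneg_left h5 h7
      _ = _ := by ring
end
end

section
open MeasureTheory ProbabilityTheory
open scoped BigOperators
noncomputable section

lemma eps_bound (M : ℕ) (hM : 1 ≤ M) (lam : ℝ) (hlam : 0 < lam)
    (hlam2 : lam^2 = 2 * M * Real.log (Real.exp 1 * M)) :
    4 / (2 * lam / M)^2 * Real.exp ((2 * lam / M)^2 * M / 2 - 2 * (2 * lam / M) * lam)
      ≤ 1 / (M:ℝ)^3 := by
  have hM' : (1:ℝ) ≤ M := by exact_mod_cast hM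
  have hM0 : (0:ℝ) < M := by linarith
  have hX : (0:ℝ) < Real.exp 1 * M := by positivity
  have hlog : 1 ≤ Real.log (Real.exp 1 * M) := by
    rw [Real.log_mul (by positivity) (by positivity), Real.log_exp]
    have := Real.log_nonneg hM'
    linarith
  have h1 : (2 * lam / M)^2 * M / 2 - 2 * (2 * lam / M) * lam = - (Real.log (Real.exp 1 * M) * (4:ℕ)) := by
    have : (2 * lam / M)^2 * M / 2 - 2 * (2 * lam / M) * lam = -2 * lam^2 / M := by
      field_simp; ring
    rw [this, hlam2]; field_simp; push_cast; ring
  rw [h1, Real.exp_neg, mul_comm (Real.log _), Real.exp_nat_mul, Real.exp_log hX]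
  have h2 : 4 / (2 * lam / M)^2 = (M:ℝ)^2 / lam^2 := by field_simp; ring
  rw [h2]
  have h3 : (M:ℝ)^2 / lam^2 ≤ M := by
    rw [div_le_iff₀ (by positivity), hlam2]
    nlinarith [mul_pos hM0 hM0]
  have h4 : ((Real.exp 1 * M)^4)⁻¹ ≤ ((M:ℝ)^4)⁻¹ := by
    apply inv_anti₀ (by positivity)
    apply pow_le_pow_left₀ hM0.le
    have := Real.add_one_le_exp (1:ℝ)
    nlinarith
  calc (M:ℝ)^2 / lam^2 * ((Real.exp 1 * M)^4)⁻¹ ≤ M * ((M:ℝ)^4)⁻¹ :=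
        mul_le_mul h3 h4 (by positivity) hM0.le
    _ = 1 / (M:ℝ)^3 := by field_simp

lemma per_t (n M p t q : ℕ) (hM : 1 ≤ M) (hpt : p ≤ t) (htq : t < q) (hqn : q ≤ n)
    (hqp : q - p ≤ M) (lam : ℝ) (hlam : 0 < lam)
    (hlam2 : lam^2 = 2 * M * Real.log (Real.exp 1 * M)) (d : ℝ) :
    ∃ G : (Fin n → ℝ) → ℝ, Integrable G (gaussVec n 1) ∧
      ∫ z, G z ∂(gaussVec n 1) ≤ 64 / ((t - p + 1 : ℕ):ℝ) + 32 / ((q - t : ℕ):ℝ) + 2 * d^2 + 1 / M ∧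
      ∀ (z : Fin n → ℝ) (W : ℕ → ℝ), (∀ s, p ≤ s → s ≤ q → |W s| ≤ lam) →
        (∀ s, p ≤ s → s + 1 < q →
          (pad z s - W s + W (s+1) < pad z (s+1) - W (s+1) + W (s+2) → W (s+1) = lam)) →
        (∀ s, p ≤ s → s + 1 < q →
          (pad z (s+1) - W (s+1) + W (s+2) < pad z s - W s + W (s+1) → W (s+1) = -lam)) →
        |W q - W p| ≤ ((q:ℝ) - p) * d →
        (pad z t - W t + W (t+1))^2 ≤ G z := by
  have hM' : (1:ℝ) ≤ M := by exact_mod_cast hM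
  have hM0 : (0:ℝ) < M := by linarith
  obtain ⟨R, hRi, hR0, hRs, hRint⟩ := fwd n p (t - p + 1) (by omega)
  obtain ⟨R', hRi', hR0', hRs', hRint'⟩ := bwd n q (q - t) (by omega) hqn
  have hex : ∀ s u : ℕ, ∃ E : (Fin n → ℝ) → ℝ, Integrable E (gaussVec n 1) ∧ (∀ z, 0 ≤ E z) ∧
      (p ≤ s → u ≤ q → ∀ z, (max (|∑ i ∈ Finset.Ico s u, pad z i| - 2 * lam) 0)^2 ≤ E z) ∧
      ∫ z, E z ∂(gaussVec n 1) ≤ 1 / (M:ℝ)^3 := by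
    intro s u
    by_cases h : p ≤ s ∧ u ≤ q
    · obtain ⟨E, h1, h2, h3, h4⟩ := expE n s u M (by omega) (by omega) (2 * lam / M) lam (by positivity)
      exact ⟨E, h1, h2, fun _ _ => h3, h4.trans (eps_bound M hM lam hlam hlam2)⟩
    · refine ⟨fun _ => 0, integrable_zero _ _ _, fun _ => le_refl _, fun h1 h2 => absurd ⟨h1, h2⟩ h, ?_⟩
      simp
  choose E hEi hE0 hEs hEint using hex
  have hEE : ∀ s ∈ Finset.Icc p t, Integrable (fun z => ∑ u ∈ Finset.Ioc t q, E s u z) (gaussVec n 1) :=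
    fun s _ => integrable_finsetSum _ (fun u _ => hEi s u)
  have iE : Integrable (fun z => ∑ s ∈ Finset.Icc p t, ∑ u ∈ Finset.Ioc t q, E s u z) (gaussVec n 1) :=
    integrable_finsetSum _ hEE
  have iR : Integrable (fun z => 2 * R z) (gaussVec n 1) := hRi.const_mul 2
  have i1 : Integrable (fun z => 2 * R z + R' z) (gaussVec n 1) := iR.add hRi'
  have i2 : Integrable (fun z => 2 * R z + R' z + 2 * d^2) (gaussVec n 1) := i1.add (integrable_const _)
  refine ⟨fun z => 2 * R z + R' z + 2 * d^2 + ∑ s ∈ Finset.Icc p t, ∑ u ∈ Finset.Ioc t q, E s u z,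
    i2.add iE, ?_, ?_⟩
  · rw [integral_add i2 iE, integral_add i1 (integrable_const _), integral_add iR hRi',
      integral_const_mul, integral_finsetSum _ hEE]
    have hsum : ∑ s ∈ Finset.Icc p t, ∫ z, ∑ u ∈ Finset.Ioc t q, E s u z ∂(gaussVec n 1) ≤ 1 / M := by
      calc ∑ s ∈ Finset.Icc p t, ∫ z, ∑ u ∈ Finset.Ioc t q, E s u z ∂(gaussVec n 1)
          ≤ ∑ s ∈ Finset.Icc p t, ∑ u ∈ Finset.Ioc t q, 1 / (M:ℝ)^3 := by
            apply Finset.sum_le_sum; intro s _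
            rw [integral_finsetSum _ (fun u _ => hEi s u)]
            exact Finset.sum_le_sum (fun u _ => hEint s u)
        _ = ((t + 1 - p : ℕ):ℝ) * (((q - t : ℕ):ℝ) * (1 / (M:ℝ)^3)) := by
            simp [Finset.sum_const]
        _ ≤ M * (M * (1 / (M:ℝ)^3)) := by
            have a1 : ((t + 1 - p : ℕ):ℝ) ≤ M := by exact_mod_cast (by omega)
            have a2 : ((q - t : ℕ):ℝ) ≤ M := by exact_mod_cast (by omega)
            gcongr
        _ = 1 / M := by field_simp
    have : ∫ _ : Fin n → ℝ, 2 * d^2 ∂(gaussVec n 1) = 2 * d^2 := by simp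
    rw [this]
    have h64 : 64 / ((t - p + 1 : ℕ):ℝ) = 2 * (32 / ((t - p + 1 : ℕ):ℝ)) := by ring
    rw [h64]
    linarith
  · intro z W hWb hrise hdrop hd
    have hE00 : ∀ s ∈ Finset.Icc p t, 0 ≤ ∑ u ∈ Finset.Ioc t q, E s u z :=
      fun s _ => Finset.sum_nonneg (fun u _ => hE0 s u z)
    exact a3 (fun s => pad z s - W s + W (s+1)) W (pad z) lam p t q hpt htq (fun s => rfl) hlam.le
      hWb hrise hdrop (R z) (R' z) (∑ s ∈ Finset.Icc p t, ∑ u ∈ Finset.Ioc t q, E s u z) d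
      (hR0 z) (hR0' z) (Finset.sum_nonneg hE00)
      (fun u h1 h2 => hRs z u (by omega) (by omega))
      (fun s h1 h2 => hRs' z s (by omega))
      (fun s u h1 h2 h3 h4 => by
        refine (hEs s u h1 h4 z).trans ?_
        refine le_trans ?_ (Finset.single_le_sum hE00 (Finset.mem_Icc.mpr ⟨h1, h2⟩))
        exact Finset.single_le_sum (f := fun u => E s u z) (fun u _ => hE0 s u z)
          (Finset.mem_Ioc.mpr ⟨h3, h4⟩))
      hd

lemma harm (M : ℕ) : ∑ i ∈ Finset.range M, 1 / ((i + 1 : ℕ):ℝ) ≤ 1 + Real.log M := by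
  have := harmonic_le_one_add_log M
  simpa [harmonic] using this

lemma sum_left (n M : ℕ) (P : Finset ℕ) (pf : ℕ → ℕ)
    (h : ∀ t, t < n → pf t ∈ P ∧ pf t ≤ t ∧ t - pf t < M) :
    ∑ t ∈ Finset.range n, 1 / ((t - pf t + 1 : ℕ):ℝ) ≤ P.card * (1 + Real.log M) := by
  calc ∑ t ∈ Finset.range n, 1 / ((t - pf t + 1 : ℕ):ℝ)
      ≤ ∑ x ∈ P ×ˢ Finset.range M, 1 / ((x.2 + 1 : ℕ):ℝ) := by
        rw [← Finset.sum_image (s := Finset.range n) (g := fun t => (pf t, t - pf t))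
          (f := fun x : ℕ × ℕ => 1 / ((x.2 + 1 : ℕ):ℝ))]
        · apply Finset.sum_le_sum_of_subset_of_nonneg
          · intro x hx
            rw [Finset.mem_image] at hx
            obtain ⟨t, ht, rfl⟩ := hx
            obtain ⟨a, b, c⟩ := h t (by simpa using ht)
            simp [a, c]
          · intros; positivity
        · intro t ht t' ht' he
          simp only [Finset.coe_range, Set.mem_Iio] at ht ht'
          have := h t ht
          have := h t' ht'
          simp only [Prod.mk.injEq] at he
          omega
    _ = ∑ p ∈ P, ∑ i ∈ Finset.range M, 1 / ((i + 1 : ℕ):ℝ) := by rw [Finset.sum_product]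
    _ ≤ ∑ p ∈ P, (1 + Real.log M) := Finset.sum_le_sum (fun _ _ => harm M)
    _ = _ := by rw [Finset.sum_const, nsmul_eq_mul]

lemma sum_right (n M : ℕ) (P : Finset ℕ) (qf : ℕ → ℕ)
    (h : ∀ t, t < n → qf t ∈ P ∧ t < qf t ∧ qf t - t ≤ M) :
    ∑ t ∈ Finset.range n, 1 / ((qf t - t : ℕ):ℝ) ≤ P.card * (1 + Real.log M) := by
  calc ∑ t ∈ Finset.range n, 1 / ((qf t - t : ℕ):ℝ)
      = ∑ t ∈ Finset.range n, 1 / ((qf t - t - 1 + 1 : ℕ):ℝ) := by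
        apply Finset.sum_congr rfl; intro t ht
        have := h t (by simpa using ht)
        congr 3; omega
    _ ≤ ∑ x ∈ P ×ˢ Finset.range M, 1 / ((x.2 + 1 : ℕ):ℝ) := by
        rw [← Finset.sum_image (s := Finset.range n) (g := fun t => (qf t, qf t - t - 1))
          (f := fun x : ℕ × ℕ => 1 / ((x.2 + 1 : ℕ):ℝ))]
        · apply Finset.sum_le_sum_of_subset_of_nonneg
          · intro x hx
            rw [Finset.mem_image] at hx
            obtain ⟨t, ht, rfl⟩ := hx
            obtain ⟨a, b, c⟩ := h t (by simpa using ht)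
            simp [a]; omega
          · intros; positivity
        · intro t ht t' ht' he
          simp only [Finset.coe_range, Set.mem_Iio] at ht ht'
          have := h t ht
          have := h t' ht'
          simp only [Prod.mk.injEq] at he
          omega
    _ = ∑ p ∈ P, ∑ i ∈ Finset.range M, 1 / ((i + 1 : ℕ):ℝ) := by rw [Finset.sum_product]
    _ ≤ ∑ p ∈ P, (1 + Real.log M) := Finset.sum_le_sum (fun _ _ => harm M)
    _ = _ := by rw [Finset.sum_const, nsmul_eq_mul]

lemma main_rand (n M : ℕ) (hM : 1 ≤ M) (P : Finset ℕ) (val : ℕ → ℝ) (h0 : 0 ∈ P) (hn : n ∈ P)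
    (hPn : ∀ p ∈ P, p ≤ n) (hval : ∀ t, |val t| ≤ 1) (m0 : ℝ) (hm0 : 0 < m0)
    (hcons : ∀ p ∈ P, ∀ q ∈ P, p < q → (∀ s ∈ P, ¬ (p < s ∧ s < q)) →
      q - p ≤ M ∧ (val p = val q ∨ m0 ≤ (q:ℝ) - p))
    (lam : ℝ) (hlam : 0 < lam) (hlam2 : lam^2 = 2 * M * Real.log (Real.exp 1 * M)) :
    ∃ G : (Fin n → ℝ) → ℝ, Integrable G (gaussVec n 1) ∧
      ∫ z, G z ∂(gaussVec n 1) ≤ P.card * 96 * (1 + Real.log M) + n * (8 * lam^2 / m0^2) + n / M ∧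
      ∀ z : Fin n → ℝ, ∃ W : ℕ → ℝ, (∀ p ∈ P, W p = lam * val p) ∧ (∀ s, |W s| ≤ lam) ∧
        ∑ t ∈ Finset.range n, (pad z t - W t + W (t+1))^2 ≤ G z := by
  classical
  have hblk : ∀ t, ∃ p q, t < n → p ∈ P ∧ q ∈ P ∧ p ≤ t ∧ t < q ∧ ∀ s ∈ P, ¬ (p < s ∧ s < q) := by
    intro t
    by_cases ht : t < n
    · have n1 : (P.filter (· ≤ t)).Nonempty := ⟨0, by simp [h0]⟩
      have n2 : (P.filter (t < ·)).Nonempty := ⟨n, by simp [hn, ht]⟩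
      have m1 := Finset.max'_mem _ n1
      have m2 := Finset.min'_mem _ n2
      rw [Finset.mem_filter] at m1 m2
      refine ⟨(P.filter (· ≤ t)).max' n1, (P.filter (t < ·)).min' n2, fun _ =>
        ⟨m1.1, m2.1, m1.2, m2.2, ?_⟩⟩
      rintro s hs ⟨hs1, hs2⟩
      rcases le_or_gt s t with h | h
      · exact absurd (Finset.le_max' (P.filter (· ≤ t)) s (by simp [hs, h])) (by omega)
      · exact absurd (Finset.min'_le (P.filter (t < ·)) s (by simp [hs, h])) (by omega)
    · exact ⟨0, 0, fun h => absurd h ht⟩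
  choose pf qf hpq using hblk
  have hlen : ∀ t, t < n → qf t - pf t ≤ M := by
    intro t ht
    obtain ⟨a, b, c, e, f⟩ := hpq t ht
    exact (hcons _ a _ b (by omega) f).1
  set d := 2 * lam / m0 with hd
  have hG : ∀ t, ∃ G : (Fin n → ℝ) → ℝ, t < n → Integrable G (gaussVec n 1) ∧
      ∫ z, G z ∂(gaussVec n 1) ≤ 64 / ((t - pf t + 1 : ℕ):ℝ) + 32 / ((qf t - t : ℕ):ℝ) + 2 * d^2 + 1 / M ∧
      ∀ (z : Fin n → ℝ) (W : ℕ → ℝ), (∀ s, pf t ≤ s → s ≤ qf t → |W s| ≤ lam) →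
        (∀ s, pf t ≤ s → s + 1 < qf t →
          (pad z s - W s + W (s+1) < pad z (s+1) - W (s+1) + W (s+2) → W (s+1) = lam)) →
        (∀ s, pf t ≤ s → s + 1 < qf t →
          (pad z (s+1) - W (s+1) + W (s+2) < pad z s - W s + W (s+1) → W (s+1) = -lam)) →
        |W (qf t) - W (pf t)| ≤ ((qf t:ℝ) - pf t) * d →
        (pad z t - W t + W (t+1))^2 ≤ G z := by
    intro t
    by_cases ht : t < n
    · obtain ⟨a, b, c, e, f⟩ := hpq t ht
      obtain ⟨G, hG⟩ := per_t n M (pf t) t (qf t) hM c e (hPn _ b) (hlen t ht) lam hlam hlam2 d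
      exact ⟨G, fun _ => hG⟩
    · exact ⟨fun _ => 0, fun h => absurd h ht⟩
  choose G hG using hG
  have hGi : ∀ t ∈ Finset.range n, Integrable (G t) (gaussVec n 1) :=
    fun t ht => (hG t (by simpa using ht)).1
  refine ⟨fun z => ∑ t ∈ Finset.range n, G t z, integrable_finsetSum _ hGi, ?_, ?_⟩
  · rw [integral_finsetSum _ hGi]
    have hM0 : (0:ℝ) < M := by exact_mod_cast hM
    calc ∑ t ∈ Finset.range n, ∫ z, G t z ∂(gaussVec n 1)
        ≤ ∑ t ∈ Finset.range n, (64 * (1 / ((t - pf t + 1 : ℕ):ℝ)) + 32 * (1 / ((qf t - t : ℕ):ℝ))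
            + (2 * d^2 + 1 / M)) := by
          apply Finset.sum_le_sum; intro t ht
          refine (hG t (by simpa using ht)).2.1.trans (le_of_eq ?_)
          ring
      _ = 64 * ∑ t ∈ Finset.range n, 1 / ((t - pf t + 1 : ℕ):ℝ)
          + 32 * ∑ t ∈ Finset.range n, 1 / ((qf t - t : ℕ):ℝ) + n * (2 * d^2 + 1 / M) := by
          rw [Finset.sum_add_distrib, Finset.sum_add_distrib, Finset.mul_sum, Finset.mul_sum,
            Finset.sum_const, Finset.card_range, nsmul_eq_mul]
      _ ≤ 64 * (P.card * (1 + Real.log M)) + 32 * (P.card * (1 + Real.log M))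
          + n * (2 * d^2 + 1 / M) := by
          have s1 := sum_left n M P pf (fun t ht => by
            obtain ⟨a, b, c, e, f⟩ := hpq t ht
            have := hlen t ht
            exact ⟨a, c, by omega⟩)
          have s2 := sum_right n M P qf (fun t ht => by
            obtain ⟨a, b, c, e, f⟩ := hpq t ht
            have := hlen t ht
            exact ⟨b, e, by omega⟩)
          linarith
      _ = _ := by rw [hd]; field_simp; ring
  · intro z
    obtain ⟨W, hW, hK⟩ := a1_kkt n (pad z) (fun s => if s ∈ P then lam * val s else -lam)
      (fun s => if s ∈ P then lam * val s else lam) (by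
        intro s; split_ifs
        · exact le_refl _
        · linarith)
    have hWP : ∀ p ∈ P, W p = lam * val p := by
      intro p hp
      have := hW p
      simp only [hp, if_true] at this
      linarith [this.1, this.2]
    have hWb : ∀ s, |W s| ≤ lam := by
      intro s
      by_cases hs : s ∈ P
      · rw [hWP s hs, abs_mul, abs_of_pos hlam]
        have := hval s
        nlinarith
      · have := hW s
        simp only [hs, if_false] at this
        exact abs_le.mpr this
    refine ⟨W, hWP, hWb, Finset.sum_le_sum fun t ht => ?_⟩
    have ht : t < n := by simpa using ht
    obtain ⟨a, b, c, e, f⟩ := hpq t ht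
    have hqn := hPn _ b
    refine (hG t ht).2.2 z W (fun s _ _ => hWb s) (fun s h1 h2 h3 => ?_) (fun s h1 h2 h3 => ?_) ?_
    · have := (hK s (by omega)).1 h3
      rwa [if_neg (fun hp => f _ hp ⟨by omega, h2⟩)] at this
    · have := (hK s (by omega)).2 h3
      rwa [if_neg (fun hp => f _ hp ⟨by omega, h2⟩)] at this
    · have hlt : (pf t : ℝ) < qf t := by exact_mod_cast (by omega : pf t < qf t)
      have hd0 : 0 < d := by rw [hd]; positivity
      rcases (hcons _ a _ b (by omega) f).2 with h | h
      · rw [hWP _ a, hWP _ b, h, sub_self, abs_zero]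
        have : 0 < (qf t:ℝ) - pf t := by linarith
        positivity
      · calc |W (qf t) - W (pf t)| ≤ |W (qf t)| + |W (pf t)| := abs_sub _ _
          _ ≤ 2 * lam := by linarith [hWb (qf t), hWb (pf t)]
          _ = m0 * d := by rw [hd]; field_simp
          _ ≤ _ := mul_le_mul_of_nonneg_right h hd0.le
end
end

section
open MeasureTheory ProbabilityTheory
open scoped BigOperators

noncomputable section

lemma Dl1_one {n : ℕ} (θ : Fin n → ℝ) :
    Dl1 1 θ = ∑ t ∈ Finset.range (n - 1), |pad θ (t+1) - pad θ t| := by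
  simp [Dl1, DD, dseq]

/-- Structural facts about a piecewise constant vector. -/
structure PC (n k : ℕ) (θ : Fin n → ℝ) (p : ℕ → ℕ) (r : ℕ → ℝ) : Prop where
  p0 : p 0 = 0
  pk : p (k+1) = n
  inc : ∀ i ≤ k, p i < p (i+1)
  r0 : r 0 = 0
  rk : r (k+1) = 0
  rs : ∀ i, 1 ≤ i → i ≤ k → r i = 1 ∨ r i = -1
  jmp : ∀ i, 1 ≤ i → i ≤ k → r i * (pad θ (p i) - pad θ (p i - 1)) = |pad θ (p i) - pad θ (p i - 1)|
    ∧ pad θ (p i) - pad θ (p i - 1) ≠ 0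
  cst : ∀ t, 1 ≤ t → t < n → (∀ i, 1 ≤ i → i ≤ k → p i ≠ t) → pad θ t = pad θ (t - 1)

lemma PC_of (n k : ℕ) (hk : 1 ≤ k) (θ : Fin n → ℝ) (j : Fin k → ℕ) (sg : Fin k → ℝ)
    (h : IsKnotSeq 1 n θ k j sg) :
    PC n k θ (fun i => jext n 1 k j i - 1) (sgext k sg) ∧
    ∀ i ≤ k, nlen n 1 k j i = (jext n 1 k j (i+1) - 1) - (jext n 1 k j i - 1) := by
  obtain ⟨hm, hb, hkn, hs⟩ := h
  simp only [DD, Nat.sub_self, Function.iterate_zero, id] at hkn hs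
  have hb0 := hb ⟨0, hk⟩
  have hn : 2 ≤ n := by omega
  have je0 : jext n 1 k j 0 = 1 := by simp [jext]
  have jel : jext n 1 k j (k+1) = n + 1 := by simp [jext]; omega
  have jei : ∀ i, 1 ≤ i → (h : i - 1 < k) → jext n 1 k j i = j ⟨i-1, h⟩ := by
    intro i hi h
    simp only [jext]
    rw [if_neg (by omega), dif_pos h]
  have hinc : ∀ i ≤ k, jext n 1 k j i < jext n 1 k j (i+1) := by
    intro i hi
    rcases Nat.eq_zero_or_pos i with rfl | h0
    · rw [je0, jei 1 (by omega) (by omega)]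
      have := hb ⟨1-1, by omega⟩
      omega
    · rcases Nat.lt_or_ge i k with h1 | h1
      · rw [jei i h0 (by omega), jei (i+1) (by omega) (by omega)]
        apply hm
        simp only [Fin.mk_lt_mk]
        omega
      · have : i = k := by omega
        subst this
        rw [jel, jei i h0 (by omega)]
        have := hb ⟨i-1, by omega⟩
        omega
  have hpos : ∀ i, 1 ≤ jext n 1 k j i := by
    intro i
    simp only [jext]
    split_ifs with a b
    · exact le_refl _
    · have := hb ⟨i-1, b⟩
      omega
    · omega
  refine ⟨⟨by simp [je0], by simp [jel], ?_, by simp [sgext], by simp [sgext], ?_, ?_, ?_⟩, ?_⟩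
  · intro i hi
    have := hinc i hi
    have := hpos i
    omega
  · intro i h1 h2
    simp only [sgext]
    rw [dif_pos ⟨by omega, by omega⟩, hs]
    split_ifs <;> simp
  · intro i h1 h2
    have hi : i - 1 < k := by omega
    simp only [sgext]
    rw [dif_pos ⟨by omega, by omega⟩, hs, jei i h1 hi]
    have hbi := hb ⟨i-1, hi⟩
    have h3 := (hkn (j ⟨i-1,hi⟩) hbi.1 hbi.2).2 ⟨_, rfl⟩
    have e : j ⟨i-1,hi⟩ - 1 - 1 = j ⟨i-1,hi⟩ - 2 := by omega
    rw [e]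
    split_ifs with h4
    · exact ⟨by rw [abs_of_pos (by linarith)]; ring, by intro h; linarith⟩
    · have : pad θ (j ⟨i-1,hi⟩ - 1) < pad θ (j ⟨i-1,hi⟩ - 2) :=
        lt_of_le_of_ne (not_lt.1 h4) (Ne.symm h3)
      exact ⟨by rw [abs_of_neg (by linarith)]; ring, by intro h; linarith⟩
  · intro t h1 h2 h3
    have h4 := hkn (t+1) (by omega) (by omega)
    by_contra hne
    have e : t + 1 - 2 = t - 1 := by omega
    rw [e] at h4
    simp only [Nat.add_sub_cancel] at h4
    obtain ⟨i, hi⟩ := h4.1 (fun h => hne h.symm)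
    apply h3 (i.1+1) (by omega) (by omega)
    rw [jei _ (by omega) (by simpa using i.2)]
    simp [hi]
  · intro i hi
    simp only [nlen]
    have := hinc i hi
    have := hpos i
    split_ifs with h0
    · subst h0
      rw [je0]; simp
    · omega

lemma tail_ineq {n : ℕ} (θ v : Fin n → ℝ) (hv : v ∈ subdiff (fun α => Dl1 1 α) θ) (m : ℕ) (hm : m < n) (e : ℝ) :
    e * ∑ t ∈ Finset.Ico m n, pad v t ≤ if m = 0 then 0 else
      |pad θ m - pad θ (m-1) + e| - |pad θ m - pad θ (m-1)| := by
  have h := hv (fun i => θ i + if m ≤ i.1 then e else 0)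
  simp only [Dl1_one, add_sub_cancel_left] at h
  have e1 : ∑ i : Fin n, v i * (if m ≤ i.1 then e else 0) = e * ∑ t ∈ Finset.Ico m n, pad v t := by
    have : ∀ i : Fin n, v i * (if m ≤ i.1 then e else 0) = (fun t => if m ≤ t then e * pad v t else 0) i.1 := by
      intro i
      simp only [pad_val]
      split_ifs <;> ring
    rw [Finset.sum_congr rfl (fun i _ => this i), Fin.sum_univ_eq_sum_range (fun t => if m ≤ t then e * pad v t else 0), ← Finset.sum_filter, Finset.mul_sum]
    apply Finset.sum_congr _ (fun _ _ => rfl)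
    ext t; simp; omega
  rw [e1] at h
  have e2 : ∀ t, t < n → pad (fun i : Fin n => θ i + if m ≤ i.1 then e else 0) t = pad θ t + if m ≤ t then e else 0 := by
    intro t ht
    rw [pad_lt _ _ ht, pad_lt _ _ ht]
  have e3 : ∑ t ∈ Finset.range (n-1), |pad (fun i : Fin n => θ i + if m ≤ i.1 then e else 0) (t+1) - pad (fun i : Fin n => θ i + if m ≤ i.1 then e else 0) t| 
      = ∑ t ∈ Finset.range (n-1), (|pad θ (t+1) - pad θ t| + if t + 1 = m then |pad θ m - pad θ (m-1) + e| - |pad θ m - pad θ (m-1)| else 0) := by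
    apply Finset.sum_congr rfl
    intro t ht
    rw [Finset.mem_range] at ht
    rw [e2 t (by omega), e2 (t+1) (by omega)]
    by_cases h1 : t + 1 = m
    · subst h1
      rw [if_pos (le_refl _), if_neg (by omega), if_pos rfl]
      simp only [Nat.add_sub_cancel]
      rw [show pad θ (t+1) + e - (pad θ t + 0) = pad θ (t+1) - pad θ t + e by ring]
      ring
    · rw [if_neg h1]
      by_cases h2 : m ≤ t
      · rw [if_pos h2, if_pos (by omega)]; simp
      · rw [if_neg h2, if_neg (by omega)]; simp
  rw [e3, Finset.sum_add_distrib] at h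
  have h' := le_of_add_le_add_left h
  refine h'.trans (le_of_eq ?_)
  split_ifs with hm0
  · subst hm0; simp
  · rw [Finset.sum_eq_single (m-1)]
    · rw [if_pos (by omega)]
    · intro b _ hb; rw [if_neg (by omega)]
    · intro hb; exfalso; apply hb; rw [Finset.mem_range]; omega

lemma tail_eq {n k : ℕ} {θ : Fin n → ℝ} {p : ℕ → ℕ} {r : ℕ → ℝ} (H : PC n k θ p r) (hpl : ∀ i ≤ k, p i < n) (v : Fin n → ℝ) (hv : v ∈ subdiff (fun α => Dl1 1 α) θ)
    (i : ℕ) (hi : i ≤ k + 1) : ∑ t ∈ Finset.Ico (p i) n, pad v t = r i := by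
  rcases Nat.lt_or_ge k i with h1 | h1
  · have : i = k + 1 := by omega
    subst this
    rw [H.pk, H.rk]; simp
  have hp := hpl i h1
  rcases Nat.eq_zero_or_pos i with rfl | h0
  · have a := tail_ineq θ v hv (p 0) hp 1
    have b := tail_ineq θ v hv (p 0) hp (-1)
    rw [if_pos H.p0] at a b
    rw [H.r0]; linarith
  · obtain ⟨j1, j2⟩ := H.jmp i h0 h1
    have hne : p i ≠ 0 := by
      have := H.inc (i-1) (by omega)
      rw [show i - 1 + 1 = i by omega] at this
      omega
    set d := pad θ (p i) - pad θ (p i - 1)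
    have a := tail_ineq θ v hv (p i) hp d
    have b := tail_ineq θ v hv (p i) hp (-d)
    rw [if_neg hne] at a b
    change _ ≤ |d + d| - |d| at a
    change _ ≤ |d + -d| - |d| at b
    rw [← two_mul, abs_mul] at a
    simp at a b
    have : (∑ t ∈ Finset.Ico (p i) n, pad v t) * d = r i * d := by
      rw [j1]; linarith
    exact mul_right_cancel₀ j2 this

lemma PC.mono {n k : ℕ} {θ : Fin n → ℝ} {p : ℕ → ℕ} {r : ℕ → ℝ} (H : PC n k θ p r) (i j : ℕ) (hij : i < j) (hj : j ≤ k + 1) : p i < p j := by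
  induction j with
  | zero => omega
  | succ j ih =>
    rcases Nat.lt_or_ge i j with h | h
    · exact (ih h (by omega)).trans (H.inc j (by omega))
    · have : i = j := by omega
      subst this
      exact H.inc i (by omega)

lemma PC.mono_le {n k : ℕ} {θ : Fin n → ℝ} {p : ℕ → ℕ} {r : ℕ → ℝ} (H : PC n k θ p r) (i j : ℕ) (hij : i ≤ j) (hj : j ≤ k + 1) : p i ≤ p j := by
  rcases Nat.lt_or_ge i j with h | h
  · exact (H.mono i j h hj).le
  · have : i = j := by omega
    rw [this]

lemma PC.lt_n {n k : ℕ} {θ : Fin n → ℝ} {p : ℕ → ℕ} {r : ℕ → ℝ} (H : PC n k θ p r) (i : ℕ) (hi : i ≤ k) : p i < n := by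
  have := H.mono i (k+1) (by omega) le_rfl
  rwa [H.pk] at this

lemma piece_eq {n k : ℕ} {θ : Fin n → ℝ} {p : ℕ → ℕ} {r : ℕ → ℝ} (H : PC n k θ p r) (v : Fin n → ℝ)
    (hv : v ∈ affineSpan ℝ (subdiff (fun α => Dl1 1 α) θ))
    (i : ℕ) (hi : i ≤ k) : ∑ t ∈ Finset.Ico (p i) (p (i+1)), pad v t = r i - r (i+1) := by
  have pm : ∀ (c d : ℝ) (x y : Fin n → ℝ) t, pad (c • (x - y) + d • x) t = c * (pad x t - pad y t) + d * pad x t := by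
    intro c d x y t
    unfold pad
    split_ifs <;> simp
  refine affineSpan_induction (p := fun v => ∑ t ∈ Finset.Ico (p i) (p (i+1)), pad v t = r i - r (i+1)) hv ?_ ?_
  · intro v hv
    have a := tail_eq H H.lt_n v hv i (by omega)
    have b := tail_eq H H.lt_n v hv (i+1) (by omega)
    have := Finset.sum_Ico_consecutive (fun t => pad v t) (H.inc i hi).le (H.mono_le (i+1) (k+1) (by omega) le_rfl)
    rw [H.pk] at this
    linarith
  · intro c u v w hu hv hw
    have : ∀ t, pad (c • (u -ᵥ v) +ᵥ w) t = c * (pad u t - pad v t) + pad w t := by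
      intro t
      unfold pad
      split_ifs <;> simp
    simp only [this, Finset.sum_add_distrib, ← Finset.mul_sum, Finset.sum_sub_distrib]
    rw [hu, hv, hw]; ring

lemma mem_sub {n k : ℕ} {θ : Fin n → ℝ} {p : ℕ → ℕ} {r : ℕ → ℝ} (H : PC n k θ p r) (W : ℕ → ℝ)
    (hW : ∀ i ≤ k + 1, W (p i) = r i) (hb : ∀ t, |W t| ≤ 1) :
    (fun i : Fin n => W i.1 - W (i.1+1)) ∈ subdiff (fun α => Dl1 1 α) θ := by
  intro y
  simp only [Dl1_one]
  have hW0 : W 0 = 0 := by have := hW 0 (by omega); rwa [H.p0, H.r0] at this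
  have hWn : W n = 0 := by have := hW (k+1) (by omega); rwa [H.pk, H.rk] at this
  have e1 : ∑ i : Fin n, (W i.1 - W (i.1+1)) * (y i - θ i) = ∑ t ∈ Finset.range n, (W t - W (t+1)) * (pad y t - pad θ t) := by
    rw [← Fin.sum_univ_eq_sum_range (fun t => (W t - W (t+1)) * (pad y t - pad θ t))]
    simp only [pad_val]
  have e2 : ∀ g : ℕ → ℝ, ∀ m, ∑ t ∈ Finset.range (m+1), (W t - W (t+1)) * g t = W 0 * g 0 - W (m+1) * g m + ∑ t ∈ Finset.range m, W (t+1) * (g (t+1) - g t) := by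
    intro g m
    induction m with
    | zero => simp; ring
    | succ m ih => rw [Finset.sum_range_succ, ih, Finset.sum_range_succ _ m]; ring
  have hn : n = n - 1 + 1 := by
    have := H.lt_n 0 (by omega)
    omega
  rw [e1]
  have e3 := e2 (fun t => pad y t - pad θ t) (n-1)
  rw [← hn, hW0, hWn] at e3
  rw [e3]
  simp only [zero_mul, sub_zero, zero_add]
  rw [← Finset.sum_add_distrib]
  apply Finset.sum_le_sum
  intro t ht
  rw [Finset.mem_range] at ht
  have key : W (t+1) * (pad θ (t+1) - pad θ t) = |pad θ (t+1) - pad θ t| := by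
    by_cases h : ∃ i, 1 ≤ i ∧ i ≤ k ∧ p i = t + 1
    · obtain ⟨i, h1, h2, h3⟩ := h
      have a := (H.jmp i h1 h2).1
      rw [← hW i (by omega), h3] at a
      simpa using a
    · push Not at h
      have := H.cst (t+1) (by omega) (by omega) h
      simp at this
      rw [this]; simp
  have h2 : W (t+1) * (pad y (t+1) - pad y t) ≤ |pad y (t+1) - pad y t| := by
    refine (le_abs_self _).trans ?_
    rw [abs_mul]
    exact mul_le_of_le_one_left (abs_nonneg _) (hb _)
  linarith
end
end

section
open MeasureTheory ProbabilityTheory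
open scoped BigOperators

noncomputable section

lemma sqnorm_nonneg {n : ℕ} (x : Fin n → ℝ) : 0 ≤ sqnorm x := Finset.sum_nonneg fun _ _ => sq_nonneg _

lemma min_orth {n : ℕ} (S : Set (Fin n → ℝ)) (v0 v : Fin n → ℝ) (h : IsMinNormIn v0 (affineSpan ℝ S : Set (Fin n → ℝ)))
    (hv : v ∈ S) : ∑ i, v i * v0 i = sqnorm v0 := by
  set a := ∑ i, v0 i * (v i - v0 i) with ha
  set b := sqnorm (v - v0) with hb
  have hb0 : 0 ≤ b := sqnorm_nonneg _
  have key : ∀ e : ℝ, 0 ≤ 2 * e * a + e^2 * b := by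
    intro e
    have hm : AffineMap.lineMap v0 v e ∈ affineSpan ℝ S :=
      AffineMap.lineMap_mem e h.1 (mem_affineSpan ℝ hv)
    have h2 := h.2 _ hm
    unfold eunorm at h2
    have h3 := (Real.sqrt_le_sqrt_iff (sqnorm_nonneg _)).1 h2
    have : sqnorm (AffineMap.lineMap v0 v e) = sqnorm v0 + (2 * e * a + e^2 * b) := by
      rw [ha, hb]
      simp only [sqnorm, Finset.mul_sum, ← Finset.sum_add_distrib]
      apply Finset.sum_congr rfl
      intro i _
      simp [AffineMap.lineMap_apply]
      ring
    linarith
  have ha0 : a = 0 := by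
    have h1 := key (-a / (b+1))
    have h2 : 2 * (-a / (b+1)) * a + (-a / (b+1))^2 * b = - (a^2 * (b + 2)) / (b+1)^2 := by
      field_simp; ring
    rw [h2] at h1
    have h3 : 0 ≤ -(a^2 * (b+2)) := by
      by_contra hc
      have := div_neg_of_neg_of_pos (not_le.1 hc) (by positivity : 0 < (b+1)^2)
      linarith
    have : a^2 ≤ 0 := by nlinarith [sq_nonneg a]
    exact pow_eq_zero_iff (two_ne_zero) |>.1 (le_antisymm this (sq_nonneg _))
  have : ∑ i, v i * v0 i - sqnorm v0 = a := by
    rw [ha]; simp only [sqnorm, ← Finset.sum_sub_distrib]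
    apply Finset.sum_congr rfl
    intro i _; ring
  linarith

lemma cs {n : ℕ} (x y : Fin n → ℝ) : ∑ i, x i * y i ≤ eunorm x * eunorm y := by
  unfold eunorm
  rw [← Real.sqrt_mul (sqnorm_nonneg _)]
  apply Real.le_sqrt_of_sq_le
  exact Finset.sum_mul_sq_le_sq_mul_sq _ _ _

lemma lam_point {n : ℕ} (S : Set (Fin n → ℝ)) (v0 : Fin n → ℝ) (h : IsMinNormIn v0 (affineSpan ℝ S : Set (Fin n → ℝ)))
    (hpos : 0 < sqnorm v0) (lam : (Fin n → ℝ) → ℝ) (hlam : IsLamFun S lam) (z v : Fin n → ℝ) (hv : v ∈ S) (μ g : ℝ) (hμ : 0 ≤ μ)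
    (hg : sqnorm (z - μ • v) ≤ g) (s : ℝ) (hs : 0 < s) :
    lam z ≤ (∑ i, z i * v0 i) / sqnorm v0 + (g / s + s) / (2 * eunorm v0) := by
  obtain ⟨h0, h1⟩ := hlam z
  have hE : 0 < eunorm v0 := Real.sqrt_pos.2 hpos
  have hE2 : eunorm v0 ^ 2 = sqnorm v0 := Real.sq_sqrt hpos.le
  have up : distSet z (scaleSet μ S) ≤ eunorm (z - μ • v) := by
    apply csInf_le
    · refine ⟨0, ?_⟩
      rintro _ ⟨w, _, rfl⟩
      exact Real.sqrt_nonneg _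
    · exact ⟨μ • v, ⟨v, hv, rfl⟩, rfl⟩
  have lo : (lam z * sqnorm v0 - ∑ i, z i * v0 i) / eunorm v0 ≤ distSet z (scaleSet (lam z) S) := by
    apply le_csInf
    · exact ⟨_, _, ⟨v, hv, rfl⟩, rfl⟩
    · rintro _ ⟨_, ⟨w, hw, rfl⟩, rfl⟩
      rw [div_le_iff₀ hE]
      have c := cs (z - lam z • w) (-v0)
      have e1 : eunorm (-v0) = eunorm v0 := by simp [eunorm, sqnorm]
      have e2 : ∑ i, (z - lam z • w) i * (-v0) i = lam z * (∑ i, w i * v0 i) - ∑ i, z i * v0 i := by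
        rw [Finset.mul_sum, ← Finset.sum_sub_distrib]
        apply Finset.sum_congr rfl
        intro i _; simp; ring
      rw [e1, e2, min_orth S v0 w h hw] at c
      exact c
  have up2 : eunorm (z - μ • v) ≤ (g / s + s) / 2 := by
    set q := eunorm (z - μ • v) with hq
    have : q^2 ≤ g := by rw [hq, eunorm, Real.sq_sqrt (sqnorm_nonneg _)]; exact hg
    have h3 : q ≤ (q^2 / s + s) / 2 := by
      rw [le_div_iff₀ two_pos, ← sub_nonneg]
      have : q^2 / s + s - q * 2 = (q - s)^2 / s := by field_simp; ring
      rw [this]; positivity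
    refine h3.trans ?_
    gcongr
  have h4 : (lam z * sqnorm v0 - ∑ i, z i * v0 i) / eunorm v0 ≤ (g / s + s) / 2 :=
    lo.trans ((h1 μ hμ).trans (up.trans up2))
  rw [div_le_iff₀ hE] at h4
  rw [← hE2] at h4 ⊢
  have h5 : lam z = ((lam z * eunorm v0 ^2 - ∑ i, z i * v0 i) + ∑ i, z i * v0 i) / eunorm v0 ^2 := by
    field_simp; ring
  rw [h5]
  have h6 : (∑ i, z i * v0 i) / eunorm v0 ^2 + (g / s + s) / (2 * eunorm v0) = ((g / s + s) / 2 * eunorm v0 + ∑ i, z i * v0 i) / eunorm v0 ^2 := by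
    field_simp; ring
  rw [h6]
  gcongr

lemma coord_mean (n : ℕ) (i : Fin n) : ∫ z : Fin n → ℝ, z i ∂(gaussVec n 1) = 0 := by
  rw [gaussVec_one]
  have := integral_comp_eval (μ := fun _ : Fin n => gaussianReal 0 1) (i := i) (f := fun x : ℝ => x) (by fun_prop)
  rw [this]
  simp

lemma lam_int {n : ℕ} (S : Set (Fin n → ℝ)) (v0 : Fin n → ℝ) (h : IsMinNormIn v0 (affineSpan ℝ S : Set (Fin n → ℝ)))
    (hpos : 0 < sqnorm v0) (lam : (Fin n → ℝ) → ℝ) (hlam : IsLamFun S lam) (G : (Fin n → ℝ) → ℝ) (hG : Integrable G (gaussVec n 1))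
    (V : ℝ) (hV : 0 < V) (hGV : ∫ z, G z ∂(gaussVec n 1) ≤ V) (μ : ℝ) (hμ : 0 ≤ μ)
    (hz : ∀ z, ∃ v ∈ S, sqnorm (z - μ • v) ≤ G z) :
    ∫ z, lam z ∂(gaussVec n 1) ≤ Real.sqrt V / eunorm v0 := by
  have hE : 0 < eunorm v0 := Real.sqrt_pos.2 hpos
  by_cases hi : Integrable lam (gaussVec n 1)
  swap
  · rw [integral_undef hi]; positivity
  set s := Real.sqrt V with hs
  have hs0 : 0 < s := Real.sqrt_pos.2 hV
  have hs2 : s^2 = V := Real.sq_sqrt hV.le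
  have ic : ∀ i : Fin n, Integrable (fun z : Fin n → ℝ => z i * v0 i) (gaussVec n 1) := fun i =>
    ((coord_memLp n i).integrable (by norm_num)).mul_const _
  have i1 : Integrable (fun z : Fin n → ℝ => (∑ i, z i * v0 i) / sqnorm v0) (gaussVec n 1) :=
    (integrable_finsetSum _ fun i _ => ic i).div_const _
  have i2 : Integrable (fun z : Fin n → ℝ => (G z / s + s) / (2 * eunorm v0)) (gaussVec n 1) :=
    ((hG.div_const _).add (integrable_const _)).div_const _
  calc ∫ z, lam z ∂(gaussVec n 1) ≤ ∫ z, ((∑ i, z i * v0 i) / sqnorm v0 + (G z / s + s) / (2 * eunorm v0)) ∂(gaussVec n 1) := by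
        apply integral_mono hi (i1.add i2)
        intro z
        obtain ⟨v, hv, hg⟩ := hz z
        exact lam_point S v0 h hpos lam hlam z v hv μ (G z) hμ hg s hs0
    _ = ((∫ z, G z ∂(gaussVec n 1)) / s + s) / (2 * eunorm v0) := by
        rw [integral_add i1 i2, integral_div, integral_div, integral_add (hG.div_const _) (integrable_const _), integral_div,
          integral_finsetSum _ (fun i _ => ic i)]
        simp [integral_mul_const, coord_mean]
    _ ≤ (V / s + s) / (2 * eunorm v0) := by gcongr
    _ = s / eunorm v0 := by rw [← hs2]; field_simp; ring

lemma r_diff {n k : ℕ} {θ : Fin n → ℝ} {p : ℕ → ℕ} {r : ℕ → ℝ} (H : PC n k θ p r) (i : ℕ) (hi : i ≤ k + 1) :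
    r i = 0 ∨ r i = 1 ∨ r i = -1 := by
  rcases Nat.eq_zero_or_pos i with rfl | h0
  · exact Or.inl H.r0
  rcases Nat.lt_or_ge k i with h1 | h1
  · have : i = k + 1 := by omega
    subst this
    exact Or.inl H.rk
  · exact Or.inr (H.rs i h0 h1)

lemma norm_lower {n k : ℕ} {θ : Fin n → ℝ} {p : ℕ → ℕ} {r : ℕ → ℝ} (H : PC n k θ p r) (v : Fin n → ℝ)
    (hv : v ∈ affineSpan ℝ (subdiff (fun α => Dl1 1 α) θ)) (B : ℝ) (hB : 0 < B)
    (hlen : ∀ i ≤ k, r i ≠ r (i+1) → ((p (i+1) - p i : ℕ) : ℝ) ≤ B) :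
    (∑ i ∈ Finset.range (k+1), if r i ≠ r (i+1) then (1:ℝ) else 0) / B ≤ sqnorm v := by
  have e1 : sqnorm v = ∑ t ∈ Finset.range n, (pad v t)^2 := by
    rw [← Fin.sum_univ_eq_sum_range (fun t => (pad v t)^2)]
    simp only [pad_val, sqnorm]
  have e2 : ∀ m, m ≤ k + 1 → ∑ t ∈ Finset.range (p m), (pad v t)^2 = ∑ i ∈ Finset.range m, ∑ t ∈ Finset.Ico (p i) (p (i+1)), (pad v t)^2 := by
    intro m
    induction m with
    | zero => intro _; simp [H.p0]
    | succ m ih =>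
      intro hm
      rw [Finset.sum_range_succ, ← ih (by omega), Finset.sum_range_add_sum_Ico _ (H.inc m (by omega)).le]
  have e3 := e2 (k+1) le_rfl
  rw [H.pk] at e3
  rw [e1, e3, Finset.sum_div]
  apply Finset.sum_le_sum
  intro i hi
  rw [Finset.mem_range] at hi
  split_ifs with hne
  · have h1 := piece_eq H v hv i (by omega)
    have h2 := sq_sum_le_card_mul_sum_sq (s := Finset.Ico (p i) (p (i+1))) (f := fun t => pad v t)
    rw [h1, Nat.card_Ico] at h2
    have h3 : 1 ≤ (r i - r (i+1))^2 := by
      rcases r_diff H i (by omega) with a | a | a <;> rcases r_diff H (i+1) (by omega) with b | b | b <;> rw [a, b] at hne ⊢ <;> simp at hne ⊢ <;> norm_num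
    have h4 := hlen i (by omega) hne
    rw [div_le_iff₀ hB]
    have h5 : 0 ≤ ∑ t ∈ Finset.Ico (p i) (p (i+1)), (pad v t)^2 := Finset.sum_nonneg fun _ _ => sq_nonneg _
    nlinarith [mul_le_mul_of_nonneg_right h4 h5]
  · simp only [zero_div]; exact Finset.sum_nonneg fun _ _ => sq_nonneg _
end
end

section
open MeasureTheory ProbabilityTheory
open scoped BigOperators

noncomputable section

/-- index of the piece containing `t`. -/
def idx (p : ℕ → ℕ) (k t : ℕ) : ℕ := Nat.findGreatest (fun i => p i ≤ t) (k+1)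

lemma idx_le (p : ℕ → ℕ) (k t : ℕ) : idx p k t ≤ k + 1 := Nat.findGreatest_le _

lemma idx_spec {n k : ℕ} {θ : Fin n → ℝ} {p : ℕ → ℕ} {r : ℕ → ℝ} (H : PC n k θ p r) (t : ℕ) (ht : t < n) :
    idx p k t ≤ k ∧ p (idx p k t) ≤ t ∧ t < p (idx p k t + 1) := by
  have h1 : p (idx p k t) ≤ t :=
    Nat.findGreatest_spec (P := fun i => p i ≤ t) (Nat.zero_le (k+1)) (by rw [H.p0]; omega)
  have h2 : idx p k t ≤ k := by
    by_contra hc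
    have : idx p k t = k + 1 := by have := idx_le p k t; omega
    rw [this, H.pk] at h1
    omega
  refine ⟨h2, h1, ?_⟩
  have := Nat.findGreatest_is_greatest (P := fun i => p i ≤ t) (n := k+1) (k := idx p k t + 1) (by unfold idx; omega) (by omega)
  omega

lemma idx_uniq {n k : ℕ} {θ : Fin n → ℝ} {p : ℕ → ℕ} {r : ℕ → ℝ} (H : PC n k θ p r) (t i : ℕ) (hi : i ≤ k)
    (h1 : p i ≤ t) (h2 : t < p (i+1)) : idx p k t = i := by
  have hn : t < n := by
    have := H.mono_le (i+1) (k+1) (by omega) le_rfl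
    rw [H.pk] at this
    omega
  obtain ⟨a, b, c⟩ := idx_spec H t hn
  rcases Nat.lt_trichotomy (idx p k t) i with h | h | h
  · have := H.mono_le (idx p k t + 1) i (by omega) (by omega)
    omega
  · exact h
  · have := H.mono_le (i+1) (idx p k t) (by omega) (by omega)
    omega

lemma idx_p {n k : ℕ} {θ : Fin n → ℝ} {p : ℕ → ℕ} {r : ℕ → ℝ} (H : PC n k θ p r) (i : ℕ) (hi : i ≤ k+1) :
    idx p k (p i) = i := by
  rcases Nat.lt_or_ge k i with h1 | h1
  · have : i = k + 1 := by omega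
    subst this
    apply le_antisymm (idx_le _ _ _)
    exact Nat.le_findGreatest (P := fun i => p i ≤ p (k+1)) le_rfl le_rfl
  · exact idx_uniq H _ i h1 le_rfl (H.inc i h1)

open Classical in
/-- The set of pins. -/
def pins (n k M : ℕ) (p : ℕ → ℕ) (r : ℕ → ℝ) : Finset ℕ :=
  (Finset.range (n+1)).filter fun t => (∃ i ≤ k+1, p i = t) ∨ (M ∣ t ∧ r (idx p k t) = r (idx p k t + 1))

lemma mem_pins (n k M : ℕ) (p : ℕ → ℕ) (r : ℕ → ℝ) (t : ℕ) : t ∈ pins n k M p r ↔ t ≤ n ∧ ((∃ i ≤ k+1, p i = t) ∨ (M ∣ t ∧ r (idx p k t) = r (idx p k t + 1))) := by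
  simp [pins, Nat.lt_succ_iff]

lemma p_mem {n k : ℕ} {θ : Fin n → ℝ} {p : ℕ → ℕ} {r : ℕ → ℝ} (H : PC n k θ p r) (M i : ℕ) (hi : i ≤ k + 1) :
    p i ∈ pins n k M p r := by
  rw [mem_pins]
  refine ⟨?_, Or.inl ⟨i, hi, rfl⟩⟩
  have := H.mono_le i (k+1) hi le_rfl
  rwa [H.pk] at this

lemma pins_card (n k M : ℕ) (hM : 1 ≤ M) (p : ℕ → ℕ) (r : ℕ → ℝ) : (pins n k M p r).card ≤ (k + 2) + (n / M + 1) := by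
  have hs : pins n k M p r ⊆ (Finset.range (k+2)).image p ∪ (Finset.range (n/M+1)).image (fun a => M * a) := by
    intro t ht
    rw [mem_pins] at ht
    rw [Finset.mem_union, Finset.mem_image, Finset.mem_image]
    rcases ht with ⟨h1, ⟨i, hi, h2⟩ | ⟨⟨a, ha⟩, _⟩⟩
    · exact Or.inl ⟨i, Finset.mem_range.2 (by omega), h2⟩
    · refine Or.inr ⟨a, ?_, ha.symm⟩
      rw [Finset.mem_range, Nat.lt_succ_iff, Nat.le_div_iff_mul_le (by omega)]
      rw [mul_comm]; omega
  refine (Finset.card_le_card hs).trans ((Finset.card_union_le _ _).trans ?_)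
  have a := Finset.card_image_le (s := Finset.range (k+2)) (f := p)
  have b := Finset.card_image_le (s := Finset.range (n/M+1)) (f := fun a => M * a)
  rw [Finset.card_range] at a b
  omega

lemma pins_cons {n k : ℕ} {θ : Fin n → ℝ} {p : ℕ → ℕ} {r : ℕ → ℝ} (H : PC n k θ p r) (M : ℕ) (hM : 1 ≤ M) (m0 : ℝ)
    (hlen : ∀ i ≤ k, r i ≠ r (i+1) → m0 ≤ ((p (i+1) - p i : ℕ) : ℝ) ∧ p (i+1) - p i ≤ M) :
    ∀ a ∈ pins n k M p r, ∀ q ∈ pins n k M p r, a < q → (∀ s ∈ pins n k M p r, ¬ (a < s ∧ s < q)) →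
      q - a ≤ M ∧ (r (idx p k a) = r (idx p k q) ∨ m0 ≤ (q:ℝ) - a) := by
  intro a ha q hq haq hno
  have hqn := ((mem_pins _ _ _ _ _ _).1 hq).1
  obtain ⟨i1, i2, i3⟩ := idx_spec H a (by omega)
  set i := idx p k a with hi
  have hq2 : q ≤ p (i+1) := by
    by_contra hc
    exact hno _ (p_mem H M (i+1) (by omega)) ⟨i3, by omega⟩
  by_cases hr : r i = r (i+1)
  · constructor
    · by_contra hc
      have d1 := Nat.div_add_mod a M
      have d2 := Nat.mod_lt a (show M > 0 by omega)
      have e : M * (a / M + 1) = M * (a/M) + M := by ring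
      refine hno (M * (a / M + 1)) ?_ ⟨by omega, by omega⟩
      have h1 : idx p k (M * (a / M + 1)) = i := idx_uniq H _ i i1 (by omega) (by omega)
      rw [mem_pins]
      exact ⟨by omega, Or.inr ⟨dvd_mul_right _ _, by rw [h1]; exact hr⟩⟩
    · left
      rcases Nat.lt_or_ge q (p (i+1)) with h | h
      · rw [idx_uniq H q i i1 (by omega) h]
      · have : q = p (i+1) := by omega
        rw [this, idx_p H (i+1) (by omega)]; exact hr
  · have ea : a = p i := by
      rcases ((mem_pins _ _ _ _ _ _).1 ha).2 with ⟨l, hl, h2⟩ | ⟨_, h2⟩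
      · have := idx_p H l hl
        rw [h2] at this
        rw [hi, this, h2]
      · exact absurd h2 hr
    have eq : q = p (i+1) := by
      by_contra hc
      have h1 : idx p k q = i := idx_uniq H q i i1 (by omega) (by omega)
      rcases ((mem_pins _ _ _ _ _ _).1 hq).2 with ⟨l, hl, h2⟩ | ⟨_, h2⟩
      · have := idx_p H l hl
        rw [h2, h1] at this
        rw [← this] at h2
        omega
      · rw [h1] at h2
        exact absurd h2 hr
    obtain ⟨l1, l2⟩ := hlen i i1 hr
    rw [ea, eq]
    refine ⟨l2, Or.inr ?_⟩
    rwa [Nat.cast_sub (H.inc i i1).le] at l1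

lemma arithV (n k M P c₁ c₂ : ℝ) (hk : 1 ≤ k) (hn : k + 1 ≤ n) (hc₁ : 0 < c₁) (hc₂ : 1 ≤ c₂)
    (hM : c₂ * (n / (k+1)) ≤ M) (hM2 : M ≤ 2 * c₂ * (n / (k+1))) (hP : P ≤ (k + 2) + (n / M + 1)) (lam : ℝ)
    (hlam : lam^2 = 2 * M * Real.log (Real.exp 1 * M)) :
    P * 96 * (1 + Real.log M) + n * (8 * lam^2 / (c₁ * (n / (k+1)))^2) + n / M ≤
      (385 + 32 * c₂ / c₁^2) * (1 + Real.log (2 * c₂)) * ((k+1) * Real.log (Real.exp 1 * n / (k+1))) := by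
  have hk0 : 0 < k + 1 := by linarith
  set L := n / (k+1) with hL
  have hL1 : 1 ≤ L := by rw [hL, le_div_iff₀ hk0]; linarith
  have hnL : n = (k+1) * L := by rw [hL]; field_simp
  have hM1 : 1 ≤ M := by nlinarith
  have hMp : 0 < M := by linarith
  have hl : Real.log (Real.exp 1 * M) = 1 + Real.log M := by
    rw [Real.log_mul (Real.exp_pos 1).ne' hMp.ne', Real.log_exp]
  have hl2 : Real.log (Real.exp 1 * n / (k+1)) = 1 + Real.log L := by
    rw [mul_div_assoc, Real.log_mul (Real.exp_pos 1).ne' (by positivity), Real.log_exp]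
  rw [hl2, hlam, hl]
  set x := 1 + Real.log M with hx
  have hx1 : 1 ≤ x := by have := Real.log_nonneg hM1; linarith
  have hnM : n / M ≤ k + 1 := by
    rw [div_le_iff₀ hMp, hnL]
    apply mul_le_mul_of_nonneg_left _ hk0.le
    nlinarith
  have t1 : P * 96 * x ≤ 384 * (k+1) * x := by
    apply mul_le_mul_of_nonneg_right _ (by linarith)
    linarith
  have t2 : n * (8 * (2 * M * x) / (c₁ * L)^2) ≤ 32 * c₂ / c₁^2 * (k+1) * x := by
    have : n * (8 * (2 * M * x) / (c₁ * L)^2) = 16 / c₁^2 * (k+1) * x * (M / L) := by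
      rw [hnL]; field_simp; ring
    rw [this]
    have h2 : M / L ≤ 2 * c₂ := by rw [div_le_iff₀ (by linarith)]; exact hM2
    calc _ ≤ 16 / c₁^2 * (k+1) * x * (2 * c₂) := by gcongr
      _ = _ := by ring
  have t3 : n / M ≤ (k+1) * x := by nlinarith
  have hxx : x ≤ (1 + Real.log (2 * c₂)) * (1 + Real.log L) := by
    have h1 : Real.log M ≤ Real.log (2 * c₂ * L) := Real.log_le_log hMp hM2
    rw [Real.log_mul (by linarith) (by linarith)] at h1
    have a := Real.log_nonneg hL1
    have b := Real.log_nonneg (show 1 ≤ 2 * c₂ by linarith)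
    nlinarith [mul_nonneg a b]
  calc _ ≤ (385 + 32 * c₂ / c₁^2) * (k+1) * x := by linarith
    _ ≤ (385 + 32 * c₂ / c₁^2) * (k+1) * ((1 + Real.log (2 * c₂)) * (1 + Real.log L)) := by gcongr
    _ = _ := by ring

lemma arithF (n k c₂ K N I e s : ℝ) (hk : 1 ≤ k) (hn : k + 1 ≤ n) (hc₂ : 1 ≤ c₂) (hK : 0 < K) (hN : 0 < N)
    (hs : N / (c₂ * n / (k+1)) ≤ s) (he : e = Real.sqrt s)
    (hI : I ≤ Real.sqrt (K * ((k+1) * Real.log (Real.exp 1 * n / (k+1)))) / e) :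
    I + 2 / e ≤ ((Real.sqrt K + 2) * Real.sqrt c₂) * Real.sqrt (n / N * Real.log (Real.exp 1 * n / (k+1))) := by
  have hk0 : 0 < k + 1 := by linarith
  have hn0 : 0 < n := by linarith
  set l := Real.log (Real.exp 1 * n / (k+1)) with hl
  have hl1 : 1 ≤ l := by
    rw [hl, mul_div_assoc, Real.log_mul (Real.exp_pos 1).ne' (by positivity), Real.log_exp]
    have := Real.log_nonneg (show 1 ≤ n / (k+1) by rw [le_div_iff₀ hk0]; linarith)
    linarith
  set e0 := Real.sqrt (N / (c₂ * n / (k+1))) with he0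
  have e0p : 0 < e0 := Real.sqrt_pos.2 (by positivity)
  have hee : e0 ≤ e := by rw [he]; exact Real.sqrt_le_sqrt hs
  have h1 : 1 ≤ Real.sqrt ((k+1) * l) := by
    rw [Real.one_le_sqrt]; nlinarith
  calc I + 2 / e ≤ (Real.sqrt (K * ((k+1) * l)) + 2) / e := by rw [add_div]; linarith
    _ ≤ (Real.sqrt (K * ((k+1) * l)) + 2) / e0 := by gcongr
    _ ≤ ((Real.sqrt K + 2) * Real.sqrt ((k+1) * l)) / e0 := by
        gcongr
        rw [Real.sqrt_mul hK.le]
        nlinarith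
    _ = _ := by
        rw [mul_div_assoc, mul_assoc, he0, ← Real.sqrt_div (by positivity), ← Real.sqrt_mul (by positivity)]
        congr 2
        field_simp

lemma stmt8_aux (c₁ c₂ : ℝ) (hc₁0 : 0 < c₁) (hc₂ : 1 ≤ c₂) (n : ℕ) (θ : Fin n → ℝ) (k : ℕ) (hk : 1 ≤ k)
    (p : ℕ → ℕ) (r : ℕ → ℝ) (H : PC n k θ p r)
    (hlen : ∀ i ≤ k, r i ≠ r (i+1) → c₁ * (n : ℝ) / ((k : ℝ) + 1) ≤ ((p (i+1) - p i : ℕ) : ℝ) ∧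
        ((p (i+1) - p i : ℕ) : ℝ) ≤ c₂ * (n : ℝ) / ((k : ℝ) + 1))
    (v0 : Fin n → ℝ) (hv0 : IsMinNormIn v0 ((affineSpan ℝ (subdiff (fun α => Dl1 1 α) θ) : Set (Fin n → ℝ))))
    (lamfun : (Fin n → ℝ) → ℝ) (hlam : IsLamFun (subdiff (fun α => Dl1 1 α) θ) lamfun) :
    (∫ z, lamfun z ∂gaussVec n 1) + 2 / eunorm v0 ≤
      ((Real.sqrt ((385 + 32 * c₂ / c₁^2) * (1 + Real.log (2 * c₂))) + 2) * Real.sqrt c₂) *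
       Real.sqrt ((n : ℝ) / (∑ i ∈ Finset.range (k + 1), if r i ≠ r (i + 1) then (1 : ℝ) else 0) *
              Real.log (Real.exp 1 * (n : ℝ) / ((k : ℝ) + 1))) := by
  have hkn : k + 1 ≤ n := by
    have : ∀ m, m ≤ k + 1 → m ≤ p m := by
      intro m
      induction m with
      | zero => intro _; omega
      | succ m ih => intro hm; have := ih (by omega); have := H.inc m (by omega); omega
    have := this (k+1) le_rfl
    rwa [H.pk] at this
  have hkR : (1:ℝ) ≤ k := by exact_mod_cast hk
  have hknR : (k:ℝ) + 1 ≤ n := by exact_mod_cast hkn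
  have hk0 : (0:ℝ) < k + 1 := by linarith
  have hn0 : (0:ℝ) < n := by linarith
  set L : ℝ := (n:ℝ) / (k+1) with hL
  have hL1 : 1 ≤ L := by rw [hL, le_div_iff₀ hk0]; linarith
  have hcL : 1 ≤ c₂ * L := by nlinarith
  set M := ⌈c₂ * L⌉₊ with hMd
  have hM1 : c₂ * L ≤ M := Nat.le_ceil _
  have hM2 : (M:ℝ) ≤ 2 * c₂ * L := by
    have := Nat.ceil_lt_add_one (show 0 ≤ c₂ * L by linarith)
    linarith
  have hMpos : 1 ≤ M := by
    have : (1:ℝ) ≤ M := by linarith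
    exact_mod_cast this
  have hMR : (1:ℝ) ≤ M := by exact_mod_cast hMpos
  have hlogpos : 0 < Real.log (Real.exp 1 * M) := by
    rw [Real.log_mul (Real.exp_pos 1).ne' (by linarith), Real.log_exp]
    have := Real.log_nonneg hMR
    linarith
  set lam := Real.sqrt (2 * M * Real.log (Real.exp 1 * M)) with hlamd
  have hlp : 0 < lam := Real.sqrt_pos.2 (by positivity)
  have hl2 : lam^2 = 2 * M * Real.log (Real.exp 1 * M) := Real.sq_sqrt (by positivity)
  have rb : ∀ i ≤ k+1, |r i| ≤ 1 := by
    intro i hi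
    rcases r_diff H i hi with h | h | h <;> rw [h] <;> norm_num
  obtain ⟨G, hGi, hGE, hGz⟩ := main_rand n M hMpos (pins n k M p r) (fun t => r (idx p k t))
    (by have := p_mem H M 0 (by omega); rwa [H.p0] at this)
    (by have := p_mem H M (k+1) le_rfl; rwa [H.pk] at this)
    (fun t ht => ((mem_pins _ _ _ _ _ _).1 ht).1)
    (fun t => rb _ (idx_le _ _ _)) (c₁ * L) (by positivity)
    (pins_cons H M hMpos (c₁ * L) (by
      intro i hi hr
      obtain ⟨a, b⟩ := hlen i hi hr
      rw [mul_div_assoc] at a b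
      exact ⟨a, by exact_mod_cast b.trans hM1⟩)) lam hlp hl2
  have hcard : ((pins n k M p r).card : ℝ) ≤ (k + 2) + ((n:ℝ) / M + 1) := by
    have h1 : ((pins n k M p r).card : ℝ) ≤ (((k + 2) + (n / M + 1) : ℕ) : ℝ) := by
      exact_mod_cast pins_card n k M hMpos p r
    have h2 : ((n / M : ℕ) : ℝ) ≤ (n:ℝ) / M := Nat.cast_div_le
    push_cast at h1
    linarith
  have hV := hGE.trans (arithV n k M _ c₁ c₂ hkR hknR hc₁0 hc₂ hM1 hM2 hcard lam hl2)
  have hNpos : 0 < ∑ i ∈ Finset.range (k + 1), if r i ≠ r (i + 1) then (1 : ℝ) else 0 := by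
    apply Finset.sum_pos'
    · intro i _; split_ifs <;> norm_num
    · refine ⟨0, by simp, ?_⟩
      rw [if_pos]
      · norm_num
      · rw [H.r0]
        rcases H.rs 1 le_rfl hk with h | h <;> rw [h] <;> norm_num
  have hs := norm_lower H v0 hv0.1 (c₂ * n / (k+1)) (by positivity) (fun i hi hr => (hlen i hi hr).2)
  have hsp : 0 < sqnorm v0 := lt_of_lt_of_le (by positivity) hs
  have hlogn : 0 < Real.log (Real.exp 1 * n / (k+1)) := by
    rw [mul_div_assoc, Real.log_mul (Real.exp_pos 1).ne' (by positivity), Real.log_exp]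
    have := Real.log_nonneg hL1
    linarith
  have hlogc : 0 ≤ Real.log (2 * c₂) := Real.log_nonneg (by linarith)
  have hI := lam_int _ v0 hv0 hsp lamfun hlam G hGi _ (by positivity) hV lam hlp.le (by
    intro z
    obtain ⟨W, w1, w2, w3⟩ := hGz z
    refine ⟨_, mem_sub H (fun t => W t / lam) ?_ ?_, ?_⟩
    · intro i hi
      rw [w1 _ (p_mem H M i hi), idx_p H i hi]
      field_simp
    · intro t
      rw [abs_div, abs_of_pos hlp, div_le_one hlp]
      exact w2 t
    · refine le_trans (le_of_eq ?_) w3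
      rw [← Fin.sum_univ_eq_sum_range (fun t => (pad z t - W t + W (t+1))^2)]
      simp only [pad_val, sqnorm]
      apply Finset.sum_congr rfl
      intro i _
      simp only [Pi.sub_apply, Pi.smul_apply, smul_eq_mul]
      field_simp
      ring)
  exact arithF n k c₂ _ _ _ (eunorm v0) (sqnorm v0) hkR hknR hc₂ (by positivity) hNpos hs rfl hI
end
end

/-- Lemma: explicit bound on `λ*` for `r = 1` under the two-sided
length condition. -/
theorem stmt8 (c₁ c₂ : ℝ) (hc₁0 : 0 < c₁) (hc₁1 : c₁ ≤ 1) (hc₂ : 1 ≤ c₂) :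
    ∃ C : ℝ, 0 < C ∧
      ∀ (n : ℕ) (θstar : Fin n → ℝ) (k : ℕ), 1 ≤ k →
        ∀ (j : Fin k → ℕ) (sg : Fin k → ℝ), IsKnotSeq 1 n θstar k j sg →
        (∀ i ≤ k, sgext k sg i ≠ sgext k sg (i + 1) →
          c₁ * (n : ℝ) / ((k : ℝ) + 1) ≤ (nlen n 1 k j i : ℝ) ∧
            (nlen n 1 k j i : ℝ) ≤ c₂ * (n : ℝ) / ((k : ℝ) + 1)) →
        ∀ v0 : Fin n → ℝ,
          IsMinNormIn v0
            ((affineSpan ℝ (subdiff (fun α => Dl1 1 α) θstar) : Set (Fin n → ℝ))) →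
        ∀ lamfun : (Fin n → ℝ) → ℝ, IsLamFun (subdiff (fun α => Dl1 1 α) θstar) lamfun →
          (∫ z, lamfun z ∂gaussVec n 1) + 2 / eunorm v0 ≤
            C * Real.sqrt ((n : ℝ) /
              (∑ i ∈ Finset.range (k + 1),
                if sgext k sg i ≠ sgext k sg (i + 1) then (1 : ℝ) else 0) *
              Real.log (Real.exp 1 * (n : ℝ) / ((k : ℝ) + 1))) := by
  refine ⟨(Real.sqrt ((385 + 32 * c₂ / c₁^2) * (1 + Real.log (2 * c₂))) + 2) * Real.sqrt c₂, ?_, ?_⟩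
  · have : 0 < Real.sqrt c₂ := Real.sqrt_pos.2 (by linarith)
    positivity
  · intro n θ k hk j sg hks hlen v0 hv0 lamfun hlam
    obtain ⟨H, hn⟩ := PC_of n k hk θ j sg hks
    refine stmt8_aux c₁ c₂ hc₁0 hc₂ n θ k hk _ _ H ?_ v0 hv0 lamfun hlam
    intro i hi hr
    have := hlen i hi hr
    rw [hn i hi] at this
    exact this
end
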